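/- arXiv:2506.18909 — 3 statements merged into one kernel-verified Lean document; each statement's English description precedes it below -/
import Mathlib

section
/- Let X be a complex Banach space, n ≥ 1, and let f : [0,∞)^n → X be locally Bochner integrable. If λ⁰ = (λ₁⁰,…,λₙ⁰) ∈ Ω_b(f) and λ = (λ₁,…,λₙ) ∈ ℂⁿ satisfies Re λⱼ > Re λⱼ⁰ for every j ∈ {1,…,n}, then λ ∈ Ω_b(f) and λ ∈ Ω(f), i.e. the Laplace integral of f converges at λ. -/
open MeasureTheory Set Filter

noncomputable section

/-- The nonnegative orthant `[0,∞)^n`. -/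
def orthant (n : ℕ) : Set (Fin n → ℝ) := {t | ∀ j, 0 ≤ t j}

/-- The box `[0,t₁] × … × [0,tₙ]`. -/
def box {n : ℕ} (t : Fin n → ℝ) : Set (Fin n → ℝ) := Set.univ.pi fun j => Set.Icc 0 (t j)

variable {X : Type*} [NormedAddCommGroup X] [NormedSpace ℂ X]

/-- The Laplace kernel `t ↦ e^{-λ₁t₁-…-λₙtₙ} f(t)`. -/
def lapKer {n : ℕ} (lam : Fin n → ℂ) (f : (Fin n → ℝ) → X) : (Fin n → ℝ) → X :=
  fun t => Complex.exp (-(∑ j, lam j * (t j : ℂ))) • f t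

/-- Absolute convergence of the Laplace integral at `lam`: membership in `Ω_abs(f)`. -/
def OmegaAbs {n : ℕ} (f : (Fin n → ℝ) → X) (lam : Fin n → ℂ) : Prop :=
  IntegrableOn (lapKer lam f) (orthant n)

/-- The (absolutely convergent) Laplace transform `(Lf)(λ)`. -/
def lapTr {n : ℕ} (f : (Fin n → ℝ) → X) (lam : Fin n → ℂ) : X :=
  ∫ t in orthant n, lapKer lam f t

/-- The truncated Laplace integral `I(f,λ,t)`. -/
def truncInt {n : ℕ} (f : (Fin n → ℝ) → X) (lam : Fin n → ℂ) (t : Fin n → ℝ) : X :=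
  ∫ s in box t, lapKer lam f s

/-- Convergence of the Laplace integral at `lam` with value `F`. -/
def LapConvTo {n : ℕ} (f : (Fin n → ℝ) → X) (lam : Fin n → ℂ) (F : X) : Prop :=
  ∀ ε > 0, ∃ M > 0, ∀ t : Fin n → ℝ, (∀ j, M < t j) → ‖truncInt f lam t - F‖ < ε

/-- Convergence of the Laplace integral at `lam`: membership in `Ω(f)`. -/
def OmegaConv {n : ℕ} (f : (Fin n → ℝ) → X) (lam : Fin n → ℂ) : Prop :=
  ∃ F, LapConvTo f lam F

/-- Boundedness of all truncated Laplace integrals: membership in `Ω_b(f)`. -/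
def OmegaBdd {n : ℕ} (f : (Fin n → ℝ) → X) (lam : Fin n → ℂ) : Prop :=
  ∃ C, ∀ t : Fin n → ℝ, ‖truncInt f lam t‖ ≤ C

/-- Local Bochner integrability on `[0,∞)^n`. -/
def LocInt {n : ℕ} (f : (Fin n → ℝ) → X) : Prop :=
  ∀ t : Fin n → ℝ, IntegrableOn f (box t)

open scoped Topology

/-- The one-sided exponential density `μ e^{-μ r}` on `(0,∞)`. -/
def expKer (mu : ℂ) : ℝ → ℂ :=
  (Set.Ioi (0 : ℝ)).indicator fun r => mu * Complex.exp (-mu * (r : ℂ))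

theorem integrable_expKer {mu : ℂ} (hmu : 0 < mu.re) : Integrable (expKer mu) :=
  (integrable_indicator_iff measurableSet_Ioi).2
    ((integrableOn_exp_mul_complex_Ioi (by simpa using hmu) 0).const_mul mu)

theorem setIntegral_Ici_expKer {mu : ℂ} (hmu : 0 < mu.re) {s : ℝ} (hs : 0 ≤ s) :
    ∫ r in Set.Ici s, expKer mu r = Complex.exp (-mu * (s : ℂ)) := by
  have hne : mu ≠ 0 := by
    rintro rfl
    simp at hmu
  rw [integral_Ici_eq_integral_Ioi]
  have hcongr : ∫ r in Set.Ioi s, expKer mu r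
      = ∫ r in Set.Ioi s, mu * Complex.exp (-mu * (r : ℂ)) :=
    setIntegral_congr_fun measurableSet_Ioi fun r hr =>
      Set.indicator_of_mem (show r ∈ Set.Ioi (0 : ℝ) from hs.trans_lt hr) _
  rw [hcongr, integral_const_mul, integral_exp_mul_complex_Ioi (by simpa using hmu)]
  field_simp

theorem integral_prod_expKer_Ici {n : ℕ} {mu : Fin n → ℂ} (hmu : ∀ j, 0 < (mu j).re)
    {s : Fin n → ℝ} (hs : ∀ j, 0 ≤ s j) :
    ∫ r in Set.Ici s, ∏ j, expKer (mu j) (r j)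
      = Complex.exp (-(∑ j, mu j * (s j : ℂ))) := by
  have hprod : (fun r : Fin n → ℝ =>
      (Set.Ici s).indicator (fun r => ∏ j, expKer (mu j) (r j)) r)
      = fun r => ∏ j, (Set.Ici (s j)).indicator (expKer (mu j)) (r j) := by
    funext r
    by_cases hr : s ≤ r
    · rw [Set.indicator_of_mem (show r ∈ Set.Ici s from hr)]
      exact Finset.prod_congr rfl fun j _ =>
        (Set.indicator_of_mem (show r j ∈ Set.Ici (s j) from hr j) _).symm
    · rw [Set.indicator_of_notMem (show r ∉ Set.Ici s from hr)]
      obtain ⟨j, hj⟩ : ∃ j, ¬ s j ≤ r j := by simpa [Pi.le_def] using hr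
      exact (Finset.prod_eq_zero (Finset.mem_univ j)
        (Set.indicator_of_notMem (show r j ∉ Set.Ici (s j) from hj) _)).symm
  rw [← integral_indicator measurableSet_Ici, hprod,
    integral_fintype_prod_volume_eq_prod (fun j => (Set.Ici (s j)).indicator (expKer (mu j))),
    ← Finset.sum_neg_distrib, Complex.exp_sum]
  refine Finset.prod_congr rfl fun j _ => ?_
  rw [integral_indicator measurableSet_Ici, setIntegral_Ici_expKer (hmu j) (hs j), neg_mul]

theorem measurableSet_box {n : ℕ} (t : Fin n → ℝ) : MeasurableSet (box t) :=
  MeasurableSet.univ_pi fun _ => measurableSet_Icc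

theorem locInt_lapKer {n : ℕ} {f : (Fin n → ℝ) → X} (hf : LocInt f) (lam : Fin n → ℂ) :
    LocInt (lapKer lam f) := fun t =>
  (hf t).continuousOn_smul (by fun_prop) (isCompact_univ_pi fun _ => isCompact_Icc)

theorem lapKer_eq_smul_lapKer {n : ℕ} (lam0 lam : Fin n → ℂ) (f : (Fin n → ℝ) → X)
    (s : Fin n → ℝ) :
    lapKer lam f s
      = Complex.exp (-(∑ j, (lam j - lam0 j) * (s j : ℂ))) • lapKer lam0 f s := by
  simp only [lapKer, smul_smul, ← Complex.exp_add]
  congr 2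
  simp only [sub_mul, Finset.sum_sub_distrib]
  ring

theorem mem_box_inf {n : ℕ} {r t s : Fin n → ℝ} : s ∈ box (r ⊓ t) ↔ s ≤ r ∧ s ∈ box t := by
  simp only [box, Set.mem_univ_pi, Set.mem_Icc, Pi.inf_apply, le_inf_iff, Pi.le_def]
  grind

theorem integrable_prod_indicator_le {n : ℕ} {k : (Fin n → ℝ) → ℂ} (hk : Integrable k)
    {g : (Fin n → ℝ) → X} {t : Fin n → ℝ} (hg : IntegrableOn g (box t)) :
    Integrable (fun p : (Fin n → ℝ) × (Fin n → ℝ) =>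
      {p : (Fin n → ℝ) × (Fin n → ℝ) | p.2 ≤ p.1}.indicator
        (fun p => k p.1 • (box t).indicator g p.2) p) (volume.prod volume) :=
  (hk.smul_prod ((integrable_indicator_iff (measurableSet_box t)).2 hg)).indicator
    (isClosed_le continuous_snd continuous_fst).measurableSet

theorem integral_indicator_le_eq_smul_setIntegral_box {n : ℕ} (k : (Fin n → ℝ) → ℂ)
    (g : (Fin n → ℝ) → X) (t r : Fin n → ℝ) :
    ∫ s, {p : (Fin n → ℝ) × (Fin n → ℝ) | p.2 ≤ p.1}.indicator
        (fun p => k p.1 • (box t).indicator g p.2) (r, s)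
      = k r • ∫ s in box (r ⊓ t), g s := by
  rw [← integral_indicator (measurableSet_box _), ← integral_smul]
  congr 1
  funext s
  by_cases h1 : s ≤ r <;> by_cases h2 : s ∈ box t <;>
    simp [Set.indicator, mem_box_inf, h1, h2]

theorem integrable_smul_setIntegral_box_inf {n : ℕ} {k : (Fin n → ℝ) → ℂ} (hk : Integrable k)
    {g : (Fin n → ℝ) → X} {t : Fin n → ℝ} (hg : IntegrableOn g (box t)) :
    Integrable fun r => k r • ∫ s in box (r ⊓ t), g s := by
  simpa only [integral_indicator_le_eq_smul_setIntegral_box] using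
    (integrable_prod_indicator_le hk hg).integral_prod_left

/-- Integration by parts in all variables: the truncated integral at `lam` is an average of
truncated integrals at `lam0` against a product of exponential densities. -/
theorem truncInt_eq_integral_smul_truncInt [CompleteSpace X] {n : ℕ} {f : (Fin n → ℝ) → X}
    (hf : LocInt f) {lam0 lam : Fin n → ℂ} (h : ∀ j, (lam0 j).re < (lam j).re)
    (t : Fin n → ℝ) :
    truncInt f lam t
      = ∫ r : Fin n → ℝ, (∏ j, expKer (lam j - lam0 j) (r j)) • truncInt f lam0 (r ⊓ t) := by
  have hmu : ∀ j, 0 < (lam j - lam0 j).re := fun j => by simpa using h j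
  have hk : Integrable fun r : Fin n → ℝ => ∏ j, expKer (lam j - lam0 j) (r j) :=
    Integrable.fintype_prod fun j => integrable_expKer (hmu j)
  have hswap := integral_integral_swap
    (f := fun r s => {p : (Fin n → ℝ) × (Fin n → ℝ) | p.2 ≤ p.1}.indicator
      (fun p => (∏ j, expKer (lam j - lam0 j) (p.1 j)) • (box t).indicator (lapKer lam0 f) p.2)
      (r, s))
    (integrable_prod_indicator_le hk (locInt_lapKer hf lam0 t))
  simp only [integral_indicator_le_eq_smul_setIntegral_box
    (fun r : Fin n → ℝ => ∏ j, expKer (lam j - lam0 j) (r j))] at hswap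
  simp only [truncInt]
  rw [hswap, ← integral_indicator (measurableSet_box t)]
  congr 1
  funext s
  by_cases hs : s ∈ box t
  · have hinner : (fun r : Fin n → ℝ => {p : (Fin n → ℝ) × (Fin n → ℝ) | p.2 ≤ p.1}.indicator
        (fun p => (∏ j, expKer (lam j - lam0 j) (p.1 j)) •
          (box t).indicator (lapKer lam0 f) p.2) (r, s))
        = (Set.Ici s).indicator fun r =>
          (∏ j, expKer (lam j - lam0 j) (r j)) • lapKer lam0 f s := by
      funext r
      by_cases hr : s ≤ r <;> simp [Set.indicator, hr, hs]
    rw [hinner, integral_indicator measurableSet_Ici, integral_smul_const,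
      integral_prod_expKer_Ici hmu fun j => (hs j (Set.mem_univ j)).1,
      Set.indicator_of_mem hs, lapKer_eq_smul_lapKer lam0 lam f s]
  · simp [Set.indicator, hs]

/-- If `λ⁰ ∈ Ω_b(f)` and `Re λⱼ > Re λⱼ⁰` for every `j`, then `λ ∈ Ω_b(f) ∩ Ω(f)`. -/
theorem bounded_convergence_monotone [CompleteSpace X]
    (n : ℕ) (hn : 1 ≤ n) (f : (Fin n → ℝ) → X) (hf : LocInt f)
    (lam0 lam : Fin n → ℂ) (h0 : OmegaBdd f lam0)
    (h : ∀ j, (lam0 j).re < (lam j).re) :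
    OmegaBdd f lam ∧ OmegaConv f lam := by
  obtain ⟨C, hC⟩ := h0
  set k : (Fin n → ℝ) → ℂ := fun r => ∏ j, expKer (lam j - lam0 j) (r j)
  have hk : Integrable k :=
    Integrable.fintype_prod fun j => integrable_expKer (by simpa using h j)
  have hrep : ∀ t, truncInt f lam t = ∫ r, k r • truncInt f lam0 (r ⊓ t) :=
    truncInt_eq_integral_smul_truncInt hf h
  have hbound : ∀ t r, ‖k r • truncInt f lam0 (r ⊓ t)‖ ≤ ‖k r‖ * C := fun t r => by
    rw [norm_smul]
    gcongr
    exact hC _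
  refine ⟨⟨∫ r, ‖k r‖ * C, fun t => ?_⟩, ∫ r, k r • truncInt f lam0 r, fun ε hε => ?_⟩
  · rw [hrep]
    exact norm_integral_le_of_norm_le (hk.norm.mul_const C) (ae_of_all _ (hbound t))
  · have htend : Tendsto (truncInt f lam) (Filter.pi fun _ : Fin n => (atTop : Filter ℝ))
        (𝓝 (∫ r, k r • truncInt f lam0 r)) := by
      rw [funext hrep]
      refine tendsto_integral_filter_of_dominated_convergence (fun r => ‖k r‖ * C)
        (Eventually.of_forall fun t =>
          (integrable_smul_setIntegral_box_inf hk (locInt_lapKer hf lam0 t)).aestronglyMeasurable)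
        (Eventually.of_forall fun t => ae_of_all _ (hbound t))
        (hk.norm.mul_const C) (ae_of_all _ fun r => ?_)
      refine tendsto_const_nhds.congr' ?_
      have hle : ∀ᶠ t in Filter.pi fun _ : Fin n => (atTop : Filter ℝ), r ≤ t :=
        eventually_all.2 fun j =>
          (tendsto_eval_pi (fun _ : Fin n => (atTop : Filter ℝ)) j).eventually_ge_atTop (r j)
      filter_upwards [hle] with t ht
      rw [inf_eq_left.2 ht]
    have hev := Metric.tendsto_nhds.1 htend ε hε
    obtain ⟨⟨I, M⟩, -, hM⟩ := (hasBasis_pi fun _ : Fin n => atTop_basis (α := ℝ)).mem_iff.1 hev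
    refine ⟨∑ j, |M j| + 1, by positivity, fun t ht => ?_⟩
    rw [← dist_eq_norm]
    refine hM fun j _ => ?_
    have hsum := Finset.single_le_sum (f := fun j => |M j|) (fun i _ => abs_nonneg _)
      (Finset.mem_univ j)
    exact Set.mem_Ici.2 (by linarith [ht j, le_abs_self (M j)])
end
end

section
/- Let X be a complex Banach space, n ≥ 1, ωⱼ ∈ ℝ and αⱼ ∈ (0, π/2] for j = 1,…,n, and let F : (ω₁,∞) × … × (ωₙ,∞) → X be a function. Then the following are equivalent. (i) There exists a holomorphic function f : Σ_{α₁} × … × Σ_{αₙ} → X such that for all real λⱼ > ωⱼ (j = 1,…,n) the function (t₁,…,tₙ) ↦ e^{−λ₁t₁−…−λₙtₙ} f(t₁,…,tₙ) is Bochner integrable on (0,∞)^n with integral F(λ₁,…,λₙ), and such that for all γⱼ ∈ (0,αⱼ) the set {e^{−ω₁z₁−…−ωₙzₙ} f(z₁,…,zₙ) : zⱼ ∈ Σ_{γⱼ} for all j} is bounded in X. (ii) There exists a holomorphic function F̃ : (ω₁ + Σ_{(π/2)+α₁}) × … × (ωₙ + Σ_{(π/2)+αₙ}) → X such that F̃(λ₁,…,λₙ)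 = F(λ₁,…,λₙ) for all real λⱼ > ωⱼ, and for all γⱼ ∈ (0,αⱼ) the set {(λ₁−ω₁)·…·(λₙ−ωₙ)·F̃(λ₁,…,λₙ) : λⱼ ∈ ωⱼ + Σ_{(π/2)+γⱼ} for all j} is bounded in X. -/
open MeasureTheory Set Filter

noncomputable section

variable {X : Type*} [NormedAddCommGroup X] [NormedSpace ℂ X]

/-- The open sector `Σ_α = {z ∈ ℂ ∖ {0} : |arg z| < α}`. -/
def sector (α : ℝ) : Set ℂ := {z : ℂ | z ≠ 0 ∧ |Complex.arg z| < α}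

open scoped Topology

/-! ### Holomorphic dependence of integrals on parameters -/

/-- An integral of holomorphic functions that is locally dominated in the parameter is
holomorphic. -/
theorem differentiableOn_integral_of_locally_dominated
    {E : Type*} [NormedAddCommGroup E] [NormedSpace ℂ E] [FiniteDimensional ℂ E]
    {S : Type*} [MeasurableSpace S] {μ : Measure S} {U : Set E} (hU : IsOpen U) {K : E → S → X}
    (hd : ∀ᵐ s ∂μ, DifferentiableOn ℂ (fun w => K w s) U)
    (hm : ∀ w ∈ U, AEStronglyMeasurable (K w) μ)
    (hb : ∀ w ∈ U, ∃ b : S → ℝ, Integrable b μ ∧ ∃ N ∈ 𝓝 w, ∀ᵐ s ∂μ, ∀ v ∈ N, ‖K v s‖ ≤ b s) :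
    DifferentiableOn ℂ (fun w => ∫ s, K w s ∂μ) U := by
  intro w hw
  obtain ⟨b, hbi, N, hN, hbN⟩ := hb w hw
  obtain ⟨r, hr, hrN⟩ := Metric.mem_nhds_iff.1 (inter_mem hN (hU.mem_nhds hw))
  have hsub : ∀ v ∈ Metric.ball w (r / 2), Metric.ball v (r / 2) ⊆ Metric.ball w r := by
    intro v hv
    apply Metric.ball_subset_ball'
    rw [Metric.mem_ball] at hv
    linarith
  have hwr : ∀ v ∈ Metric.ball w (r / 2), v ∈ Metric.ball w r :=
    fun v hv => Metric.ball_subset_ball (by linarith) hv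
  have hdiffAt : ∀ᵐ s ∂μ, ∀ v ∈ Metric.ball w (r / 2),
      HasFDerivAt (fun u => K u s) (fderiv ℂ (fun u => K u s) v) v := by
    filter_upwards [hd] with s hs v hv
    exact (hs.differentiableAt (hU.mem_nhds (hrN (hwr v hv)).2)).hasFDerivAt
  have hmeas : ∀ e : E, AEStronglyMeasurable (fun s => fderiv ℂ (fun u => K u s) w e) μ := by
    intro e
    have hlim : Tendsto (fun m : ℕ => ((1 : ℝ) / (m + 1) : ℝ)) atTop (𝓝[≠] 0) := by
      refine tendsto_nhdsWithin_iff.2 ⟨tendsto_one_div_add_atTop_nhds_zero_nat, ?_⟩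
      exact Eventually.of_forall fun m => by
        simp only [mem_compl_iff, mem_singleton_iff]; positivity
    have hnear : ∀ᶠ m : ℕ in atTop, w + ((1 : ℝ) / (m + 1) : ℝ) • e ∈ U := by
      have h1 : Tendsto (fun m : ℕ => w + ((1 : ℝ) / (m + 1) : ℝ) • e) atTop (𝓝 w) := by
        have := ((tendsto_one_div_add_atTop_nhds_zero_nat (𝕜 := ℝ)).smul_const e).const_add w
        simpa using this
      exact h1.eventually (hU.mem_nhds hw)
    obtain ⟨M, hM⟩ := eventually_atTop.1 hnear
    refine aestronglyMeasurable_of_tendsto_ae atTop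
      (f := fun m s => (((1 : ℝ) / ((m + M : ℕ) + 1) : ℝ)⁻¹) •
        (K (w + ((1 : ℝ) / ((m + M : ℕ) + 1) : ℝ) • e) s - K w s)) ?_ ?_
    · intro m
      exact ((hm _ (hM (m + M) (by omega))).sub (hm w hw)).const_smul _
    · filter_upwards [hdiffAt] with s hs
      have h1 := (hs w (Metric.mem_ball_self (by positivity))).hasLineDerivAt e
      have h2 : HasDerivAt (fun t : ℝ => K (w + t • e) s)
          (fderiv ℂ (fun u => K u s) w e) 0 := by
        have h3 := ((hs w (Metric.mem_ball_self (by positivity))).restrictScalars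
          ℝ).hasLineDerivAt e
        exact h3
      have h4 := h2.tendsto_slope_zero.comp (hlim.comp (tendsto_add_atTop_nat M))
      simpa [Function.comp_def] using h4
  have hmeas' : AEStronglyMeasurable (fun s => fderiv ℂ (fun u => K u s) w) μ := by
    let B := Module.finBasis ℂ E
    have : (fun s => fderiv ℂ (fun u => K u s) w) = fun s =>
        ∑ i, ContinuousLinearMap.smulRightL ℂ E X (LinearMap.toContinuousLinearMap (B.coord i))
          (fderiv ℂ (fun u => K u s) w (B i)) := by
      funext s
      ext v
      conv_lhs => rw [← B.sum_repr v]
      rw [map_sum]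
      simp
    rw [this]
    refine Finset.aestronglyMeasurable_fun_sum _ fun i _ => ?_
    exact (ContinuousLinearMap.continuous _).comp_aestronglyMeasurable (hmeas (B i))
  refine (hasFDerivAt_integral_of_dominated_of_fderiv_le (F := K)
    (F' := fun v s => fderiv ℂ (fun u => K u s) v) (bound := fun s => 2 * b s / (r / 2))
    (s := Metric.ball w (r / 2)) (Metric.ball_mem_nhds _ (by positivity)) ?_ ?_ hmeas' ?_
    ((hbi.const_mul 2).div_const _) hdiffAt).differentiableAt.differentiableWithinAt
  · filter_upwards [hU.mem_nhds hw] with v hv using hm v hv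
  · exact hbi.mono' (hm w hw) (hbN.mono fun s hs => hs w (mem_of_mem_nhds hN))
  · filter_upwards [hd, hbN] with s hs hsb v hv
    refine Complex.norm_fderiv_le_div_of_mapsTo_ball
      (hs.mono fun u hu => (hrN (hsub v hv hu)).2) ?_ (by positivity)
    intro u hu
    rw [mem_closedBall_iff_norm]
    calc ‖K u s - K v s‖ ≤ ‖K u s‖ + ‖K v s‖ := norm_sub_le _ _
      _ ≤ b s + b s := add_le_add (hsb u (hrN (hsub v hv hu)).1) (hsb v (hrN (hwr v hv)).1)
      _ = 2 * b s := by ring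

/-- A holomorphic function on a convex open set that is locally invariant under imaginary
translations is constant. -/
theorem eq_of_differentiableOn_of_add_I_mul_eq {D : Set ℂ} (hD : IsOpen D) (hc : Convex ℝ D)
    {φ : ℂ → X} (hφ : DifferentiableOn ℂ φ D)
    (hinv : ∀ τ ∈ D, ∀ᶠ σ : ℝ in 𝓝 0, φ (τ + Complex.I * σ) = φ τ) {τ τ' : ℂ} (hτ : τ ∈ D)
    (hτ' : τ' ∈ D) : φ τ = φ τ' := by
  refine hc.is_const_of_fderivWithin_eq_zero (𝕜 := ℂ) hφ (fun x hx => ?_) hτ hτ'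
  rw [fderivWithin_of_isOpen hD hx]
  have h1 : HasDerivAt φ (deriv φ x) x :=
    (hφ.differentiableAt (hD.mem_nhds hx)).hasDerivAt
  have h2 : HasDerivAt (fun σ : ℝ => x + Complex.I * (σ : ℂ)) Complex.I 0 := by
    have := ((Complex.ofRealCLM.hasDerivAt (x := 0)).const_mul Complex.I).const_add x
    simpa using this
  have h3 : HasDerivAt (fun σ : ℝ => φ (x + Complex.I * (σ : ℂ))) (Complex.I • deriv φ x) 0 := by
    refine HasDerivAt.scomp (𝕜' := ℂ) (g₁ := φ) (0 : ℝ) ?_ h2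
    simpa using h1
  have h4 : HasDerivAt (fun σ : ℝ => φ (x + Complex.I * (σ : ℂ))) 0 0 :=
    (hasDerivAt_const (0 : ℝ) (φ x)).congr_of_eventuallyEq (hinv x hx)
  have h5 : deriv φ x = 0 := by
    simpa using h3.unique h4
  ext
  simpa using h5

/-! ### Sectors -/

theorem mem_sector_iff {β : ℝ} (h0 : 0 < β) (hπ : β ≤ Real.pi) {z : ℂ} :
    z ∈ sector β ↔ ‖z‖ * Real.cos β < z.re := by
  rcases eq_or_ne z 0 with rfl | hz
  · simp [sector]
  · have hn : 0 < ‖z‖ := norm_pos_iff.2 hz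
    have h1 : |z.arg| < β ↔ Real.cos β < Real.cos |z.arg| :=
      (Real.strictAntiOn_cos.lt_iff_gt ⟨h0.le, hπ⟩
        ⟨abs_nonneg _, Complex.abs_arg_le_pi z⟩).symm
    rw [Real.cos_abs] at h1
    have h2 : z.re = ‖z‖ * Real.cos z.arg := (Complex.norm_mul_cos_arg z).symm
    rw [h2, mul_lt_mul_iff_right₀ hn, ← h1]
    simp [sector, hz]

theorem isOpen_sector {β : ℝ} (h0 : 0 < β) (hπ : β ≤ Real.pi) : IsOpen (sector β) := by
  have : sector β = {z : ℂ | ‖z‖ * Real.cos β < z.re} := by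
    ext z
    exact mem_sector_iff h0 hπ
  rw [this]
  exact isOpen_lt (by fun_prop) Complex.continuous_re

theorem sector_mono {β γ : ℝ} (h : β ≤ γ) : sector β ⊆ sector γ :=
  fun _ hz => ⟨hz.1, hz.2.trans_le h⟩

theorem isOpen_setOf_forall_mem_sector {n : ℕ} {β : Fin n → ℝ} (h0 : ∀ j, 0 < β j)
    (hπ : ∀ j, β j ≤ Real.pi) : IsOpen {z : Fin n → ℂ | ∀ j, z j ∈ sector (β j)} := by
  simp only [ofPred_forall]
  exact isOpen_iInter_of_finite fun j =>
    (isOpen_sector (h0 j) (hπ j)).preimage (continuous_apply j)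

theorem exp_mem_sector {β : ℝ} (hπ : β ≤ Real.pi) {ξ : ℂ} (h : |ξ.im| < β) :
    Complex.exp ξ ∈ sector β := by
  rw [mem_sector_iff ((abs_nonneg _).trans_lt h) hπ, Complex.norm_exp, Complex.exp_re,
    mul_lt_mul_iff_right₀ (Real.exp_pos _), ← Real.cos_abs ξ.im]
  exact Real.strictAntiOn_cos ⟨abs_nonneg _, h.le.trans hπ⟩
    ⟨(abs_nonneg _).trans h.le, hπ⟩ h

theorem mul_ofReal_mem_sector {β : ℝ} {z : ℂ} (hz : z ∈ sector β) {c : ℝ} (hc : 0 < c) :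
    z * c ∈ sector β := by
  refine ⟨mul_ne_zero hz.1 (Complex.ofReal_ne_zero.2 hc.ne'), ?_⟩
  rw [Complex.arg_mul_real hc]
  exact hz.2

theorem ofReal_mem_sector {β : ℝ} (hβ : 0 < β) {c : ℝ} (hc : 0 < c) : (c : ℂ) ∈ sector β := by
  refine ⟨Complex.ofReal_ne_zero.2 hc.ne', ?_⟩
  rw [Complex.arg_ofReal_of_nonneg hc.le]
  simpa using hβ

/-- Two holomorphic functions on a product of sectors that agree at the positive real points
agree everywhere. -/
theorem eq_of_eq_on_positive [CompleteSpace X] {n : ℕ} {δ : Fin n → ℝ}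
    (hδ : ∀ j, 0 < δ j) (hδπ : ∀ j, δ j ≤ Real.pi) {f g : (Fin n → ℂ) → X}
    (hf : DifferentiableOn ℂ f {z : Fin n → ℂ | ∀ j, z j ∈ sector (δ j)})
    (hg : DifferentiableOn ℂ g {z : Fin n → ℂ | ∀ j, z j ∈ sector (δ j)})
    (hfg : ∀ t : Fin n → ℝ, (∀ j, 0 < t j) → f (fun j => (t j : ℂ)) = g (fun j => (t j : ℂ)))
    {z : Fin n → ℂ} (hz : ∀ j, z j ∈ sector (δ j)) : f z = g z := by
  set D : Set ℂ := {u | ∀ j, |u.im * (z j).arg| < δ j} with hD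
  have hDo : IsOpen D := by
    simp only [hD, ofPred_forall]
    exact isOpen_iInter_of_finite fun j => isOpen_lt (by fun_prop) continuous_const
  have hDc : Convex ℝ D := by
    intro u hu v hv a b ha hb hab j
    have h1 := abs_lt.1 (hu j)
    have h2 := abs_lt.1 (hv j)
    simp only [Complex.add_im, Complex.real_smul, Complex.mul_im, Complex.ofReal_re,
      Complex.ofReal_im, zero_mul, add_zero]
    have h3 := (convex_Ioo (-(δ j)) (δ j)) h1 h2 ha hb hab
    simp only [smul_eq_mul] at h3
    refine abs_lt.2 ⟨?_, ?_⟩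
    · have := h3.1; linarith
    · have := h3.2; linarith
  set e : ℂ → Fin n → ℂ :=
    fun u j => Complex.exp ((Real.log ‖z j‖ : ℝ) + u * ((z j).arg : ℝ)) with he
  have hed : Differentiable ℂ e := by
    rw [differentiable_pi]
    intro j
    simp only [he]
    fun_prop
  have hem : MapsTo e D {z : Fin n → ℂ | ∀ j, z j ∈ sector (δ j)} := by
    intro u hu j
    refine exp_mem_sector (hδπ j) ?_
    simpa using hu j
  have hfa : AnalyticOnNhd ℂ (f ∘ e) D := (hf.comp hed.differentiableOn hem).analyticOnNhd hDo
  have hga : AnalyticOnNhd ℂ (g ∘ e) D := (hg.comp hed.differentiableOn hem).analyticOnNhd hDo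
  have h0 : (0 : ℂ) ∈ D := fun j => by simpa using hδ j
  have hI : Complex.I ∈ D := fun j => by simpa using (hz j).2
  have hfreq : ∃ᶠ u in 𝓝[≠] (0 : ℂ), (f ∘ e) u = (g ∘ e) u := by
    have hlim : Tendsto (fun m : ℕ => (((1 : ℝ) / (m + 1) : ℝ) : ℂ)) atTop (𝓝[≠] 0) := by
      refine tendsto_nhdsWithin_iff.2 ⟨?_, ?_⟩
      · have := (Complex.continuous_ofReal.tendsto 0).comp
          (tendsto_one_div_add_atTop_nhds_zero_nat (𝕜 := ℝ))
        simpa [Function.comp_def] using this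
      · exact Eventually.of_forall fun m => by
          simp only [mem_compl_iff, mem_singleton_iff, Complex.ofReal_eq_zero]
          positivity
    refine hlim.frequently (Eventually.of_forall fun m => ?_).frequently
    have h := hfg (fun j => Real.exp (Real.log ‖z j‖ + (1 / (m + 1)) * (z j).arg))
      (fun j => Real.exp_pos _)
    have h' : e (((1 : ℝ) / (m + 1) : ℝ) : ℂ) = fun j =>
        ((Real.exp (Real.log ‖z j‖ + (1 / (m + 1)) * (z j).arg) : ℝ) : ℂ) := by
      funext j
      simp [he]
    simp only [Function.comp_apply, h', h]
  have key := hfa.eqOn_of_preconnected_of_frequently_eq hga hDc.isPreconnected h0 hfreq hI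
  have heI : e Complex.I = z := by
    funext j
    simp only [he]
    rw [Complex.exp_add, ← Complex.ofReal_exp, Real.exp_log (norm_pos_iff.2 (hz j).1),
      mul_comm Complex.I]
    exact Complex.norm_mul_exp_arg_mul_I (z j)
  simpa [heI] using key

/-! ### Separable weights and changes of variables -/

theorem integrable_prod_inv_one_add_sq (n : ℕ) :
    Integrable fun s : Fin n → ℝ => ∏ j, (1 + s j ^ 2)⁻¹ :=
  Integrable.fintype_prod (f := fun _ (x : ℝ) => (1 + x ^ 2)⁻¹)
    fun _ => integrable_inv_one_add_sq

theorem inv_one_add_add_sq_le {s u R : ℝ} (hu : |u| ≤ R) :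
    (1 + (s + u) ^ 2)⁻¹ ≤ 2 * (1 + R ^ 2) * (1 + s ^ 2)⁻¹ := by
  have h1 : u ^ 2 ≤ R ^ 2 := by
    rw [← sq_abs u]
    exact pow_le_pow_left₀ (abs_nonneg u) hu 2
  rw [← div_eq_mul_inv, inv_eq_one_div, div_le_div_iff₀ (by positivity) (by positivity)]
  nlinarith [sq_nonneg (s + 2 * u), sq_nonneg ((s + u) * R), sq_nonneg (s + u)]

theorem setOf_forall_pos_eq_pi (n : ℕ) :
    {t : Fin n → ℝ | ∀ j, 0 < t j} = Set.univ.pi fun _ => Ioi 0 := by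
  ext t
  simp

theorem measurableSet_setOf_forall_pos (n : ℕ) :
    MeasurableSet {t : Fin n → ℝ | ∀ j, 0 < t j} := by
  rw [setOf_forall_pos_eq_pi]
  exact MeasurableSet.univ_pi fun _ => measurableSet_Ioi

theorem volume_restrict_setOf_forall_pos (n : ℕ) :
    (volume : Measure (Fin n → ℝ)).restrict {t : Fin n → ℝ | ∀ j, 0 < t j} =
      Measure.pi fun _ => volume.restrict (Ioi 0) := by
  rw [setOf_forall_pos_eq_pi, volume_pi, Measure.restrict_pi_pi]

theorem integrableOn_prod_exp_neg {n : ℕ} {c : Fin n → ℝ} (hc : ∀ j, 0 < c j) :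
    IntegrableOn (fun t : Fin n → ℝ => ∏ j, Real.exp (-(c j * t j)))
      {t : Fin n → ℝ | ∀ j, 0 < t j} := by
  rw [IntegrableOn, volume_restrict_setOf_forall_pos]
  refine Integrable.fintype_prod (f := fun j (x : ℝ) => Real.exp (-(c j * x))) fun j => ?_
  have := integrableOn_exp_mul_Ioi (a := -(c j)) (by have := hc j; linarith) 0
  simpa [IntegrableOn] using this

theorem setIntegral_prod_exp_neg {n : ℕ} {c : Fin n → ℝ} (hc : ∀ j, 0 < c j) :
    ∫ t : Fin n → ℝ in {t : Fin n → ℝ | ∀ j, 0 < t j}, ∏ j, Real.exp (-(c j * t j)) =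
      ∏ j, (c j)⁻¹ := by
  rw [volume_restrict_setOf_forall_pos,
    integral_fintype_prod_eq_prod (f := fun j (x : ℝ) => Real.exp (-(c j * x)))]
  refine Finset.prod_congr rfl fun j _ => ?_
  have := integral_exp_mul_Ioi (a := -(c j)) (by have := hc j; linarith) 0
  simpa [neg_div_neg_eq] using this

/-- Change of variables `t j = g j (s j)`, one variable at a time. -/
theorem integral_image_separable {n : ℕ} {S : Set (Fin n → ℝ)} (hS : MeasurableSet S)
    {g g' : Fin n → ℝ → ℝ} (hg : ∀ s ∈ S, ∀ j, HasDerivAt (g j) (g' j (s j)) (s j))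
    (hinj : InjOn (fun (s : Fin n → ℝ) j => g j (s j)) S) (G : (Fin n → ℝ) → X) :
    ∫ t in (fun (s : Fin n → ℝ) j => g j (s j)) '' S, G t =
      ∫ s in S, |∏ j, g' j (s j)| • G (fun j => g j (s j)) := by
  rw [integral_image_eq_integral_abs_det_fderiv_smul volume hS
    (f' := fun s => ContinuousLinearMap.pi fun j =>
      (ContinuousLinearMap.toSpanSingleton ℝ (g' j (s j))).comp (ContinuousLinearMap.proj j))
    ?_ hinj]
  · simp only [ContinuousLinearMap.det_pi, ContinuousLinearMap.det_toSpanSingleton]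
  · intro s hs
    refine (hasFDerivAt_pi.2 fun j => ?_).hasFDerivWithinAt
    exact (hg s hs j).hasFDerivAt.comp s (hasFDerivAt_apply j s)

theorem setIntegral_orthant_comp_mul {n : ℕ} {c : Fin n → ℝ} (hc : ∀ j, 0 < c j)
    (G : (Fin n → ℝ) → X) :
    ∫ s in {t : Fin n → ℝ | ∀ j, 0 < t j}, (∏ j, c j) • G (fun j => c j * s j) =
      ∫ t in {t : Fin n → ℝ | ∀ j, 0 < t j}, G t := by
  have himg : (fun (s : Fin n → ℝ) j => c j * s j) '' {t : Fin n → ℝ | ∀ j, 0 < t j} =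
      {t : Fin n → ℝ | ∀ j, 0 < t j} := by
    ext t
    constructor
    · rintro ⟨s, hs, rfl⟩ j
      exact mul_pos (hc j) (hs j)
    · intro ht
      exact ⟨fun j => t j / c j, fun j => div_pos (ht j) (hc j),
        funext fun j => mul_div_cancel₀ _ (hc j).ne'⟩
  have h := integral_image_separable (measurableSet_setOf_forall_pos n)
    (g := fun j x => c j * x) (g' := fun j _ => c j)
    (fun s _ j => by simpa using (hasDerivAt_id (s j)).const_mul (c j))
    (fun s _ s' _ hss => funext fun j => mul_left_cancel₀ (hc j).ne' (congrFun hss j)) G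
  rw [himg, abs_of_pos (Finset.prod_pos fun j _ => hc j)] at h
  exact h.symm

theorem integral_comp_separable {n : ℕ} {g g' : Fin n → ℝ → ℝ}
    (hg : ∀ j x, HasDerivAt (g j) (g' j x) x) (hbij : ∀ j, Function.Bijective (g j))
    (G : (Fin n → ℝ) → X) :
    ∫ s : Fin n → ℝ, |∏ j, g' j (s j)| • G (fun j => g j (s j)) = ∫ t, G t := by
  have h := integral_image_separable MeasurableSet.univ (fun s _ j => hg j (s j))
    (fun s _ s' _ hss => funext fun j => (hbij j).1 (congrFun hss j)) G
  have himg : (fun (s : Fin n → ℝ) j => g j (s j)) '' univ = univ :=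
    image_univ_of_surjective fun t =>
      ⟨fun j => ((hbij j).2 (t j)).choose, funext fun j => ((hbij j).2 (t j)).choose_spec⟩
  rw [himg] at h
  simpa using h.symm

/-- Vertical contours may be moved across a tube on which the integrand is holomorphic and
decays like `∏ (1 + s j ^ 2)⁻¹`. -/
theorem integral_vertical_shift {n : ℕ} {K : (Fin n → ℂ) → X} {D : Set (Fin n → ℂ)}
    (hK : DifferentiableOn ℂ K D) {p d : Fin n → ℝ} {B : ℝ}
    (hmem : ∀ x ∈ Icc (0 : ℝ) 1, ∀ s : Fin n → ℝ,
      (fun j => ((p j + x * d j : ℝ) : ℂ) + s j * Complex.I) ∈ D)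
    (hB : ∀ x ∈ Icc (0 : ℝ) 1, ∀ s : Fin n → ℝ,
      ‖K (fun j => ((p j + x * d j : ℝ) : ℂ) + s j * Complex.I)‖ ≤ B * ∏ j, (1 + s j ^ 2)⁻¹) :
    ∫ s : Fin n → ℝ, K (fun j => (p j : ℂ) + s j * Complex.I) =
      ∫ s : Fin n → ℝ, K (fun j => ((p j + d j : ℝ) : ℂ) + s j * Complex.I) := by
  set e : ℂ → (Fin n → ℝ) → Fin n → ℂ :=
    fun τ s j => (p j : ℂ) + τ * d j + s j * Complex.I with he
  set φ : ℂ → X := fun τ => ∫ s : Fin n → ℝ, K (e τ s) with hφ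
  have hcont : ∀ τ, Continuous (e τ) := fun τ => by
    refine continuous_pi fun j => ?_
    simp only [he]
    fun_prop
  have he' : ∀ τ s, e τ s = fun j => ((p j + τ.re * d j : ℝ) : ℂ) +
      ((s j + τ.im * d j : ℝ) : ℂ) * Complex.I := by
    intro τ s
    funext j
    apply Complex.ext
    · simp [he]
    · simp [he]
      ring
  have hmem' : ∀ τ : ℂ, τ.re ∈ Icc (0 : ℝ) 1 → ∀ s, e τ s ∈ D := fun τ hτ s => by
    rw [he']
    exact hmem τ.re hτ _
  have hmeas : ∀ τ : ℂ, τ.re ∈ Icc (0 : ℝ) 1 →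
      AEStronglyMeasurable (fun s => K (e τ s)) volume := fun τ hτ =>
    (hK.continuousOn.comp_continuous (hcont τ) (hmem' τ hτ)).aestronglyMeasurable
  set D' : Set ℂ := {τ | τ.re ∈ Ioo (0 : ℝ) 1} with hD'
  have hD'o : IsOpen D' := isOpen_Ioo.preimage Complex.continuous_re
  have hD'c : Convex ℝ D' := (convex_Ioo (0 : ℝ) 1).linear_preimage Complex.reLm
  have hB0 : 0 ≤ B := by
    have := (norm_nonneg _).trans (hB 0 (by simp) 0)
    simpa using this
  have hdiff : DifferentiableOn ℂ φ D' := by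
    refine differentiableOn_integral_of_locally_dominated hD'o
      (K := fun τ s => K (e τ s)) ?_ (fun τ hτ => hmeas τ (Ioo_subset_Icc_self hτ)) ?_
    · refine Eventually.of_forall fun s => hK.comp ?_
        fun τ hτ => hmem' τ (Ioo_subset_Icc_self hτ) s
      refine Differentiable.differentiableOn (differentiable_pi.2 fun j => ?_)
      simp only [he]
      fun_prop
    · intro τ hτ
      set R : ℝ := |τ.im| + 1
      refine ⟨fun s => B * ∏ j, (2 * (1 + (R * |d j|) ^ 2) * (1 + s j ^ 2)⁻¹), ?_,
        D' ∩ {v | |v.im| < R}, ?_, Eventually.of_forall fun s v hv => ?_⟩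
      · simp only [Finset.prod_mul_distrib]
        exact ((integrable_prod_inv_one_add_sq n).const_mul _).const_mul _
      · exact inter_mem (hD'o.mem_nhds hτ) ((isOpen_lt (by fun_prop) continuous_const).mem_nhds
          (by simp [R]))
      · rw [he']
        refine (hB v.re (Ioo_subset_Icc_self hv.1) _).trans ?_
        refine mul_le_mul_of_nonneg_left (Finset.prod_le_prod (fun j _ => by positivity)
          fun j _ => inv_one_add_add_sq_le ?_) hB0
        rw [abs_mul]
        exact mul_le_mul_of_nonneg_right hv.2.le (abs_nonneg _)
  have hconst : ∀ x ∈ Ioo (0 : ℝ) 1, φ x = φ ((1 / 2 : ℝ) : ℂ) := by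
    intro x hx
    refine eq_of_differentiableOn_of_add_I_mul_eq hD'o hD'c hdiff ?_ (by simpa [hD'] using hx)
      (by simp only [hD', mem_ofPred_eq, Complex.ofReal_re]; norm_num)
    refine fun τ _ => Eventually.of_forall fun σ => ?_
    simp only [hφ]
    rw [← integral_add_right_eq_self (fun s => K (e τ s)) (fun j => σ * d j)]
    congr 1
    funext s
    congr 1
    funext j
    simp only [he, Pi.add_apply]
    push_cast
    ring
  have hcontφ : ContinuousOn (fun x : ℝ => φ x) (Icc 0 1) := by
    refine continuousOn_of_dominated (F := fun (x : ℝ) s => K (e x s))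
      (bound := fun s => B * ∏ j, (1 + s j ^ 2)⁻¹)
      (fun x hx => hmeas x (by simpa using hx)) ?_
      ((integrable_prod_inv_one_add_sq n).const_mul _) ?_
    · refine fun x hx => Eventually.of_forall fun s => ?_
      rw [he']
      have := hB x hx s
      simpa using this
    · refine Eventually.of_forall fun s => hK.continuousOn.comp (Continuous.continuousOn ?_)
        fun x hx => hmem' x (by simpa using hx) s
      refine continuous_pi fun j => ?_
      simp only [he]
      fun_prop
  have hEq : EqOn (fun x : ℝ => φ x) (fun _ => φ ((1 / 2 : ℝ) : ℂ)) (Icc 0 1) :=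
    EqOn.of_subset_closure (s := Ioo 0 1) hconst hcontφ continuousOn_const Ioo_subset_Icc_self
      (by rw [closure_Ioo (by norm_num)])
  have h01 := (hEq (by simp : (0 : ℝ) ∈ Icc (0 : ℝ) 1)).trans
    (hEq (by simp : (1 : ℝ) ∈ Icc (0 : ℝ) 1)).symm
  simpa [hφ, he] using h01

/-! ### Laplace integrals along rotated rays -/

/-- The Laplace kernel of `g` along the rays `s j ↦ exp (ξ j) * s j`. -/
def rayKer {n : ℕ} (g : (Fin n → ℂ) → X) (ξ lam : Fin n → ℂ) (s : Fin n → ℝ) : X :=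
  (∏ j, (Complex.exp (ξ j) * Complex.exp (-(lam j * (Complex.exp (ξ j) * s j))))) •
    g fun j => Complex.exp (ξ j) * s j

/-- The Laplace integral of `g` along the rays `s j ↦ exp (ξ j) * s j`. -/
def rayInt {n : ℕ} (g : (Fin n → ℂ) → X) (ξ lam : Fin n → ℂ) : X :=
  ∫ s in {t : Fin n → ℝ | ∀ j, 0 < t j}, rayKer g ξ lam s

theorem re_mul_exp (lam ξ : ℂ) :
    (lam * Complex.exp ξ).re = ‖lam‖ * Real.exp ξ.re * Real.cos (lam.arg + ξ.im) := by
  rw [Complex.mul_re, Complex.exp_re, Complex.exp_im, Real.cos_add]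
  linear_combination (-(Real.exp ξ.re * Real.cos ξ.im)) * Complex.norm_mul_cos_arg lam +
    Real.exp ξ.re * Real.sin ξ.im * Complex.norm_mul_sin_arg lam

theorem rayInt_add_ofReal {n : ℕ} (g : (Fin n → ℂ) → X) (ξ lam : Fin n → ℂ) (r : Fin n → ℝ) :
    rayInt g (fun j => ξ j + r j) lam = rayInt g ξ lam := by
  rw [rayInt, rayInt, ← setIntegral_orthant_comp_mul (c := fun j => Real.exp (r j))
    (fun j => Real.exp_pos _) (rayKer g ξ lam)]
  congr 1
  funext s
  have h : ∀ j, Complex.exp (ξ j + r j) * (s j : ℂ) =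
      Complex.exp (ξ j) * ((Real.exp (r j) * s j : ℝ) : ℂ) := by
    intro j
    rw [Complex.exp_add]
    push_cast
    ring
  simp only [rayKer, h]
  rw [← Complex.coe_smul, smul_smul]
  congr 1
  push_cast
  rw [← Finset.prod_mul_distrib]
  refine Finset.prod_congr rfl fun j _ => ?_
  rw [Complex.exp_add]
  ring

theorem norm_rayKer_le {n : ℕ} {g : (Fin n → ℂ) → X} {ξ lam : Fin n → ℂ} {s : Fin n → ℝ}
    {C : ℝ} (hC : ‖g fun j => Complex.exp (ξ j) * s j‖ ≤ C) :
    ‖rayKer g ξ lam s‖ ≤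
      C * ∏ j, (Real.exp (ξ j).re * Real.exp (-((lam j * Complex.exp (ξ j)).re * s j))) := by
  rw [rayKer, norm_smul, norm_prod, mul_comm]
  have : ∀ j, ‖Complex.exp (ξ j) * Complex.exp (-(lam j * (Complex.exp (ξ j) * s j)))‖ =
      Real.exp (ξ j).re * Real.exp (-((lam j * Complex.exp (ξ j)).re * s j)) := by
    intro j
    rw [norm_mul, Complex.norm_exp, Complex.norm_exp, ← mul_assoc, Complex.neg_re,
      Complex.re_mul_ofReal]
  simp only [this]
  exact mul_le_mul_of_nonneg_right hC (Finset.prod_nonneg fun j _ => by positivity)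

section RayInt

variable {n : ℕ} {α : Fin n → ℝ} {g : (Fin n → ℂ) → X}

theorem exp_mul_ofReal_mem_sector {ξ : Fin n → ℂ} {γ : Fin n → ℝ} (hγπ : ∀ j, γ j ≤ Real.pi)
    (hξ : ∀ j, |(ξ j).im| < γ j) {s : Fin n → ℝ} (hs : ∀ j, 0 < s j) (j : Fin n) :
    Complex.exp (ξ j) * s j ∈ sector (γ j) :=
  mul_ofReal_mem_sector (exp_mem_sector (hγπ j) (hξ j)) (hs j)

theorem differentiableOn_rayInt (hα : ∀ j, 0 < α j ∧ α j ≤ Real.pi / 2)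
    (hg : DifferentiableOn ℂ g {z : Fin n → ℂ | ∀ j, z j ∈ sector (α j)})
    (hb : ∀ γ : Fin n → ℝ, (∀ j, γ j ∈ Set.Ioo 0 (α j)) →
      ∃ C, ∀ z : Fin n → ℂ, (∀ j, z j ∈ sector (γ j)) → ‖g z‖ ≤ C) :
    DifferentiableOn ℂ (fun p : (Fin n → ℂ) × (Fin n → ℂ) => rayInt g p.1 p.2)
      {p | ∀ j, |(p.1 j).im| < α j ∧ 0 < (p.2 j * Complex.exp (p.1 j)).re} := by
  have hαπ : ∀ j, α j ≤ Real.pi := fun j => by have := (hα j).2; linarith [Real.pi_pos]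
  set U : Set ((Fin n → ℂ) × (Fin n → ℂ)) :=
    {p | ∀ j, |(p.1 j).im| < α j ∧ 0 < (p.2 j * Complex.exp (p.1 j)).re} with hU
  have hUo : IsOpen U := by
    simp only [hU, ofPred_forall, ofPred_and]
    exact isOpen_iInter_of_finite fun j => (isOpen_lt (by fun_prop) continuous_const).inter
      (isOpen_lt continuous_const (by fun_prop))
  have hO := measurableSet_setOf_forall_pos n
  refine differentiableOn_integral_of_locally_dominated hUo
    (K := fun p s => rayKer g p.1 p.2 s) ?_ ?_ ?_
  · refine (ae_restrict_iff' hO).2 (Eventually.of_forall fun s hs => ?_)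
    refine DifferentiableOn.smul (Differentiable.differentiableOn ?_) (hg.comp ?_ ?_)
    · fun_prop
    · refine Differentiable.differentiableOn (differentiable_pi.2 fun j => ?_)
      fun_prop
    · exact fun p hp => exp_mul_ofReal_mem_sector hαπ (fun j => (hp j).1) hs
  · intro p hp
    refine ContinuousOn.aestronglyMeasurable ?_ hO
    refine ContinuousOn.smul (Continuous.continuousOn (by fun_prop))
      (hg.continuousOn.comp (Continuous.continuousOn (by fun_prop)) ?_)
    exact fun s hs => exp_mul_ofReal_mem_sector hαπ (fun j => (hp j).1) hs
  · intro p hp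
    have hγ : ∀ j, ∃ γ, |(p.1 j).im| < γ ∧ γ < α j := fun j => exists_between (hp j).1
    choose γ hγ1 hγ2 using hγ
    obtain ⟨C, hC⟩ := hb γ fun j => ⟨(abs_nonneg _).trans_lt (hγ1 j), hγ2 j⟩
    set c : Fin n → ℝ := fun j => (p.2 j * Complex.exp (p.1 j)).re / 2
    have hc : ∀ j, 0 < c j := fun j => half_pos (hp j).2
    set M : Fin n → ℝ := fun j => Real.exp (p.1 j).re + 1
    refine ⟨fun s => C * ∏ j, (M j * Real.exp (-(c j * s j))), ?_,
      {q | ∀ j, |(q.1 j).im| < γ j ∧ c j < (q.2 j * Complex.exp (q.1 j)).re ∧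
        Real.exp (q.1 j).re < M j}, ?_, ?_⟩
    · simp only [Finset.prod_mul_distrib]
      exact ((integrableOn_prod_exp_neg hc).const_mul _).const_mul _
    · refine IsOpen.mem_nhds ?_ fun j => ⟨hγ1 j, half_lt_self (hp j).2, lt_add_one _⟩
      simp only [ofPred_forall, ofPred_and]
      exact isOpen_iInter_of_finite fun j => (isOpen_lt (by fun_prop) continuous_const).inter
        ((isOpen_lt continuous_const (by fun_prop)).inter
          (isOpen_lt (by fun_prop) continuous_const))
    · refine (ae_restrict_iff' hO).2 (Eventually.of_forall fun s hs q hq => ?_)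
      have hCq := hC (fun j => Complex.exp (q.1 j) * s j) (exp_mul_ofReal_mem_sector
        (fun j => (hγ2 j).le.trans (hαπ j)) (fun j => (hq j).1) hs)
      refine (norm_rayKer_le hCq).trans (mul_le_mul_of_nonneg_left ?_
        ((norm_nonneg _).trans hCq))
      refine Finset.prod_le_prod (fun j _ => by positivity) fun j _ => ?_
      refine mul_le_mul (hq j).2.2.le (Real.exp_le_exp.2 (neg_le_neg ?_)) (Real.exp_pos _).le
        ((Real.exp_pos _).le.trans (hq j).2.2.le)
      exact mul_le_mul_of_nonneg_right (hq j).2.1.le (hs j).le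

/-- The rotated Laplace integral does not depend on the admissible angles of rotation. -/
theorem rayInt_eq_rayInt (hα : ∀ j, 0 < α j ∧ α j ≤ Real.pi / 2)
    (hg : DifferentiableOn ℂ g {z : Fin n → ℂ | ∀ j, z j ∈ sector (α j)})
    (hb : ∀ γ : Fin n → ℝ, (∀ j, γ j ∈ Set.Ioo 0 (α j)) →
      ∃ C, ∀ z : Fin n → ℂ, (∀ j, z j ∈ sector (γ j)) → ‖g z‖ ≤ C)
    {lam : Fin n → ℂ} (h0 : ∀ j, lam j ≠ 0) {θ θ' : Fin n → ℝ}
    (hθ : ∀ j, |θ j| < α j ∧ |(lam j).arg + θ j| < Real.pi / 2)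
    (hθ' : ∀ j, |θ' j| < α j ∧ |(lam j).arg + θ' j| < Real.pi / 2) :
    rayInt g (fun j => θ j * Complex.I) lam = rayInt g (fun j => θ' j * Complex.I) lam := by
  set A : Set (Fin n → ℝ) :=
    {x | ∀ j, |x j| < α j ∧ |(lam j).arg + x j| < Real.pi / 2} with hA
  have hAo : IsOpen A := by
    simp only [hA, ofPred_forall, ofPred_and]
    exact isOpen_iInter_of_finite fun j => (isOpen_lt (by fun_prop) continuous_const).inter
      (isOpen_lt (by fun_prop) continuous_const)
  have hAc : Convex ℝ A := by
    intro x hx y hy a b ha hb hab j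
    have h1 := (convex_Ioo (-(α j)) (α j)) (abs_lt.1 (hx j).1) (abs_lt.1 (hy j).1) ha hb hab
    have h2 := (convex_Ioo (-(Real.pi / 2)) (Real.pi / 2)) (abs_lt.1 (hx j).2)
      (abs_lt.1 (hy j).2) ha hb hab
    have h3 : a • ((lam j).arg + x j) + b • ((lam j).arg + y j) =
        (lam j).arg + (a * x j + b * y j) := by
      simp only [smul_eq_mul]
      linear_combination (lam j).arg * hab
    rw [h3] at h2
    exact ⟨abs_lt.2 h1, abs_lt.2 h2⟩
  set D : Set ℂ := {τ | (fun j => θ j + τ.re * (θ' j - θ j)) ∈ A} with hD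
  have hDo : IsOpen D := hAo.preimage (by fun_prop)
  have hDc : Convex ℝ D := by
    intro u hu v hv a b ha hb hab
    have := hAc hu hv ha hb hab
    have heq : (fun j => θ j + (a • u + b • v).re * (θ' j - θ j)) =
        (a • fun j => θ j + u.re * (θ' j - θ j)) + b • fun j => θ j + v.re * (θ' j - θ j) := by
      funext j
      simp only [Complex.add_re, Complex.real_smul, Complex.re_ofReal_mul, Pi.add_apply,
        Pi.smul_apply, smul_eq_mul]
      linear_combination (-(θ j)) * hab
    change (fun j => θ j + (a • u + b • v).re * (θ' j - θ j)) ∈ A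
    rw [heq]
    exact this
  set e : ℂ → Fin n → ℂ := fun τ j => ((θ j : ℂ) + τ * ((θ' j - θ j : ℝ) : ℂ)) * Complex.I
    with he
  have hφ : DifferentiableOn ℂ (fun τ => rayInt g (e τ) lam) D := by
    refine (differentiableOn_rayInt hα hg hb).comp (f := fun τ => (e τ, lam)) ?_ ?_
    · refine Differentiable.differentiableOn (Differentiable.prodMk
        (differentiable_pi.2 fun j => ?_) (by fun_prop))
      simp only [he]
      fun_prop
    · intro τ hτ j
      have him : (e τ j).im = θ j + τ.re * (θ' j - θ j) := by simp [he]
      refine ⟨by rw [him]; exact (hτ j).1, ?_⟩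
      rw [re_mul_exp, him]
      exact mul_pos (mul_pos (norm_pos_iff.2 (h0 j)) (Real.exp_pos _))
        (Real.cos_pos_of_mem_Ioo (abs_lt.1 (hτ j).2))
  have key := eq_of_differentiableOn_of_add_I_mul_eq hDo hDc hφ (τ := 0) (τ' := 1)
    (fun τ _ => Eventually.of_forall fun σ => ?_) ?_ ?_
  · simpa [he] using key
  · rw [← rayInt_add_ofReal g (e τ) lam fun j => -(σ * (θ' j - θ j))]
    congr 1
    funext j
    simp only [he]
    push_cast
    linear_combination (σ * (θ' j - θ j) : ℂ) * Complex.I_mul_I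
  · simpa [hD, hA] using hθ
  · simpa [hD, hA] using hθ'

/-- The Laplace transform of a holomorphic function that is bounded on products of smaller
sectors extends to products of sectors enlarged by a right angle. -/
theorem exists_laplace_extension (hα : ∀ j, 0 < α j ∧ α j ≤ Real.pi / 2)
    (hg : DifferentiableOn ℂ g {z : Fin n → ℂ | ∀ j, z j ∈ sector (α j)})
    (hb : ∀ γ : Fin n → ℝ, (∀ j, γ j ∈ Set.Ioo 0 (α j)) →
      ∃ C, ∀ z : Fin n → ℂ, (∀ j, z j ∈ sector (γ j)) → ‖g z‖ ≤ C) :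
    ∃ G : (Fin n → ℂ) → X,
      DifferentiableOn ℂ G {lam : Fin n → ℂ | ∀ j, lam j ∈ sector (Real.pi / 2 + α j)} ∧
      (∀ lam : Fin n → ℝ, (∀ j, 0 < lam j) → G (fun j => (lam j : ℂ)) =
        ∫ t in {t : Fin n → ℝ | ∀ j, 0 < t j},
          Complex.exp (-(∑ j, (lam j : ℂ) * (t j : ℂ))) • g (fun j => (t j : ℂ))) ∧
      (∀ γ : Fin n → ℝ, (∀ j, γ j ∈ Set.Ioo 0 (α j)) →
        ∃ C, ∀ lam : Fin n → ℂ, (∀ j, lam j ∈ sector (Real.pi / 2 + γ j)) →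
          ‖(∏ j, lam j) • G lam‖ ≤ C) := by
  have hpi := Real.pi_pos
  set κ : Fin n → ℝ := fun j => α j / (Real.pi / 2 + α j) with hκ
  have hden : ∀ j, 0 < Real.pi / 2 + α j := fun j => by have := (hα j).1; positivity
  have hκ0 : ∀ j, 0 < κ j := fun j => div_pos (hα j).1 (hden j)
  have hκ1 : ∀ j, 0 < 1 - κ j := fun j => by
    rw [sub_pos, hκ, div_lt_one (hden j)]
    linarith
  have hκα : ∀ j, κ j * (Real.pi / 2 + α j) = α j := fun j => div_mul_cancel₀ _ (hden j).ne'
  set Θ : (Fin n → ℂ) → Fin n → ℝ := fun lam j => -(κ j * (lam j).arg) with hΘ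
  have habs1 : ∀ lam j, |Θ lam j| = κ j * |(lam j).arg| := fun lam j => by
    rw [hΘ, abs_neg, abs_mul, abs_of_pos (hκ0 j)]
  have habs2 : ∀ lam j, |(lam j).arg + Θ lam j| = (1 - κ j) * |(lam j).arg| := fun lam j => by
    have : (lam j).arg + Θ lam j = (1 - κ j) * (lam j).arg := by
      simp only [hΘ]
      ring
    rw [this, abs_mul, abs_of_pos (hκ1 j)]
  have hadm : ∀ lam : Fin n → ℂ, (∀ j, lam j ∈ sector (Real.pi / 2 + α j)) →
      ∀ j, |Θ lam j| < α j ∧ |(lam j).arg + Θ lam j| < Real.pi / 2 := by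
    intro lam hlam j
    rw [habs1, habs2]
    have h1 := mul_lt_mul_of_pos_left (hlam j).2 (hκ0 j)
    have h2 := mul_lt_mul_of_pos_left (hlam j).2 (hκ1 j)
    have h3 := hκα j
    constructor
    · linarith
    · linarith
  refine ⟨fun lam => rayInt g (fun j => Θ lam j * Complex.I) lam, ?_, ?_, ?_⟩
  · intro lam hlam
    have hopen := isOpen_setOf_forall_mem_sector hden
      (fun j => by have := (hα j).2; linarith : ∀ j, Real.pi / 2 + α j ≤ Real.pi)
    have hcont : ∀ j, ContinuousAt (fun l : Fin n → ℂ => (l j).arg) lam := fun j => by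
      refine ContinuousAt.comp (f := fun l : Fin n → ℂ => l j) (g := Complex.arg)
        (Complex.continuousAt_arg ?_) (continuous_apply j).continuousAt
      rw [Complex.mem_slitPlane_iff_arg]
      refine ⟨fun h => ?_, (hlam j).1⟩
      have h1 := (hlam j).2
      rw [h, abs_of_pos hpi] at h1
      have := (hα j).2
      linarith
    have hnear : ∀ᶠ l in 𝓝 lam, ∀ j, |(l j).arg + Θ lam j| < Real.pi / 2 := by
      rw [eventually_all]
      intro j
      have : ContinuousAt (fun l : Fin n → ℂ => |(l j).arg + Θ lam j|) lam :=
        ((hcont j).add continuousAt_const).abs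
      exact this.eventually (isOpen_Iio.mem_nhds (hadm lam hlam j).2)
    have heq : (fun l => rayInt g (fun j => Θ l j * Complex.I) l) =ᶠ[𝓝 lam]
        fun l => rayInt g (fun j => Θ lam j * Complex.I) l := by
      filter_upwards [hnear, hopen.mem_nhds hlam] with l hl hl'
      exact rayInt_eq_rayInt hα hg hb (fun j => (hl' j).1) (hadm l hl')
        fun j => ⟨(hadm lam hlam j).1, hl j⟩
    refine (heq.differentiableAt_iff.2 ?_).differentiableWithinAt
    have hmem : ((fun j => (Θ lam j : ℂ) * Complex.I : Fin n → ℂ), lam) ∈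
        {p : (Fin n → ℂ) × (Fin n → ℂ) |
          ∀ j, |(p.1 j).im| < α j ∧ 0 < (p.2 j * Complex.exp (p.1 j)).re} := by
      intro j
      have him : ((Θ lam j : ℂ) * Complex.I).im = Θ lam j := by simp
      refine ⟨by simpa using (hadm lam hlam j).1, ?_⟩
      simp only
      rw [re_mul_exp, him]
      exact mul_pos (mul_pos (norm_pos_iff.2 (hlam j).1) (Real.exp_pos _))
        (Real.cos_pos_of_mem_Ioo (abs_lt.1 (hadm lam hlam j).2))
    have hopen' : IsOpen {p : (Fin n → ℂ) × (Fin n → ℂ) |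
        ∀ j, |(p.1 j).im| < α j ∧ 0 < (p.2 j * Complex.exp (p.1 j)).re} := by
      simp only [ofPred_forall, ofPred_and]
      exact isOpen_iInter_of_finite fun j => (isOpen_lt (by fun_prop) continuous_const).inter
        (isOpen_lt continuous_const (by fun_prop))
    have hd := (differentiableOn_rayInt hα hg hb).differentiableAt (hopen'.mem_nhds hmem)
    exact DifferentiableAt.comp lam (f := fun l : Fin n → ℂ =>
      ((fun j => (Θ lam j : ℂ) * Complex.I : Fin n → ℂ), l)) hd (by fun_prop)
  · intro lam hlam
    have hΘ0 : ∀ j, Θ (fun j => (lam j : ℂ)) j = 0 := fun j => by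
      simp [hΘ, Complex.arg_ofReal_of_nonneg (hlam j).le]
    simp only [hΘ0, rayInt, rayKer]
    simp [← Complex.exp_sum]
  · intro γ hγ
    set γ' : Fin n → ℝ := fun j => κ j * (Real.pi / 2 + γ j) with hγ'
    have hγ'mem : ∀ j, γ' j ∈ Ioo 0 (α j) := fun j => by
      have h1 := mul_lt_mul_of_pos_left (hγ j).2 (hκ0 j)
      refine ⟨mul_pos (hκ0 j) (by have := (hγ j).1; positivity), ?_⟩
      have := hκα j
      simp only [hγ']
      linarith
    obtain ⟨C, hC⟩ := hb γ' hγ'mem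
    set ψ : Fin n → ℝ := fun j => (1 - κ j) * (Real.pi / 2 + γ j) with hψ
    have hψ0 : ∀ j, 0 ≤ ψ j := fun j => (mul_pos (hκ1 j) (by have := (hγ j).1; positivity)).le
    have hψ1 : ∀ j, ψ j < Real.pi / 2 := fun j => by
      have h1 := mul_lt_mul_of_pos_left (hγ j).2 (hκ1 j)
      have := hκα j
      simp only [hψ]
      linarith
    have hcosψ : ∀ j, 0 < Real.cos (ψ j) := fun j =>
      Real.cos_pos_of_mem_Ioo ⟨by have := hψ0 j; linarith, hψ1 j⟩
    refine ⟨C * ∏ j, (Real.cos (ψ j))⁻¹, fun lam hlam => ?_⟩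
    set c : Fin n → ℝ := fun j => ‖lam j‖ * Real.cos (ψ j) with hc
    have hn : ∀ j, 0 < ‖lam j‖ := fun j => norm_pos_iff.2 (hlam j).1
    have hcpos : ∀ j, 0 < c j := fun j => mul_pos (hn j) (hcosψ j)
    have hbound : ∀ s : Fin n → ℝ, (∀ j, 0 < s j) →
        ‖rayKer g (fun j => Θ lam j * Complex.I) lam s‖ ≤
          C * ∏ j, Real.exp (-(c j * s j)) := by
      intro s hs
      have hCs := hC (fun j => Complex.exp (Θ lam j * Complex.I) * s j)
        (exp_mul_ofReal_mem_sector
          (fun j => by have := (hγ'mem j).2; have := (hα j).2; linarith)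
          (fun j => by
            have h1 := mul_lt_mul_of_pos_left (hlam j).2 (hκ0 j)
            simpa [habs1] using h1) hs)
      refine (norm_rayKer_le hCs).trans (mul_le_mul_of_nonneg_left ?_
        ((norm_nonneg _).trans hCs))
      refine Finset.prod_le_prod (fun j _ => by positivity) fun j _ => ?_
      rw [re_mul_exp]
      simp only [Complex.re_ofReal_mul, Complex.I_re, mul_zero, Real.exp_zero, one_mul, mul_one,
        Complex.im_ofReal_mul, Complex.I_im]
      refine Real.exp_le_exp.2 (neg_le_neg (mul_le_mul_of_nonneg_right
        (mul_le_mul_of_nonneg_left ?_ (hn j).le) (hs j).le))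
      rw [← Real.cos_abs ((lam j).arg + Θ lam j), habs2]
      refine Real.cos_le_cos_of_nonneg_of_le_pi (mul_nonneg (hκ1 j).le (abs_nonneg _))
        (by have := hψ1 j; linarith) ?_
      exact mul_le_mul_of_nonneg_left (hlam j).2.le (hκ1 j).le
    have hint : ‖rayInt g (fun j => Θ lam j * Complex.I) lam‖ ≤ C * ∏ j, (c j)⁻¹ := by
      rw [← setIntegral_prod_exp_neg hcpos, ← integral_const_mul]
      refine norm_integral_le_of_norm_le ((integrableOn_prod_exp_neg hcpos).const_mul C) ?_
      exact (ae_restrict_iff' (measurableSet_setOf_forall_pos n)).2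
        (Eventually.of_forall hbound)
    rw [norm_smul, norm_prod]
    refine (mul_le_mul_of_nonneg_left hint (by positivity)).trans_eq ?_
    rw [mul_left_comm, ← Finset.prod_mul_distrib]
    congr 1
    refine Finset.prod_congr rfl fun j _ => ?_
    rw [hc, mul_inv, ← mul_assoc, mul_inv_cancel₀ (hn j).ne', one_mul]

end RayInt

/-! ### The hyperbolas `ξ ↦ a * (1 + sin ξ)` -/

/-- The map sending vertical lines to branches of hyperbolas. -/
def hyp (a : ℝ) (ξ : ℂ) : ℂ := a * (1 + Complex.sin ξ)

theorem hyp_eq (a p s : ℝ) :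
    hyp a (p + s * Complex.I) = ((a * (1 + Real.sin p * Real.cosh s) : ℝ) : ℂ) +
      ((a * (Real.cos p * Real.sinh s) : ℝ) : ℂ) * Complex.I := by
  rw [hyp, Complex.sin_add_mul_I]
  push_cast
  ring

theorem hyp_re (a p s : ℝ) :
    (hyp a (p + s * Complex.I)).re = a * (1 + Real.sin p * Real.cosh s) := by
  rw [hyp_eq]
  simp [-Complex.ofReal_mul, -Complex.ofReal_add]

theorem hyp_im (a p s : ℝ) :
    (hyp a (p + s * Complex.I)).im = a * (Real.cos p * Real.sinh s) := by
  rw [hyp_eq]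
  simp [-Complex.ofReal_mul, -Complex.ofReal_add]

theorem norm_hyp {a : ℝ} (ha : 0 < a) (p s : ℝ) :
    ‖hyp a (p + s * Complex.I)‖ = a * (Real.cosh s + Real.sin p) := by
  have h0 : 0 ≤ a * (Real.cosh s + Real.sin p) :=
    mul_nonneg ha.le (by linarith [Real.one_le_cosh s, Real.neg_one_le_sin p])
  rw [hyp_eq, Complex.norm_add_mul_I, ← Real.sqrt_sq h0]
  congr 1
  linear_combination (-a ^ 2) * Real.cosh_sq s * (Real.cos p ^ 2) +
    a ^ 2 * (Real.cosh s ^ 2 - 1) * Real.sin_sq_add_cos_sq p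

theorem one_add_sin_pos {p : ℝ} (hp : -(Real.pi / 2) < p) (hp0 : p ≤ 0) :
    0 < 1 + Real.sin p := by
  have := Real.sin_lt_sin_of_lt_of_le_pi_div_two le_rfl (by linarith [Real.pi_pos]) hp
  rw [Real.sin_neg, Real.sin_pi_div_two] at this
  linarith

theorem sin_nonpos_of_mem {p : ℝ} (hp : -(Real.pi / 2) < p) (hp0 : p ≤ 0) :
    Real.sin p ≤ 0 :=
  Real.sin_nonpos_of_nonpos_of_neg_pi_le hp0 (by linarith [Real.pi_pos])

theorem le_norm_hyp {a : ℝ} (ha : 0 < a) {p : ℝ} (hp : -(Real.pi / 2) < p) (hp0 : p ≤ 0)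
    (s : ℝ) : a * (1 + Real.sin p) * Real.cosh s ≤ ‖hyp a (p + s * Complex.I)‖ := by
  rw [norm_hyp ha, mul_assoc]
  refine mul_le_mul_of_nonneg_left ?_ ha.le
  nlinarith [sin_nonpos_of_mem hp hp0, Real.one_le_cosh s]

theorem norm_cos_le_cosh (p s : ℝ) : ‖Complex.cos (p + s * Complex.I)‖ ≤ Real.cosh s := by
  have h : Complex.cos (p + s * Complex.I) = ((Real.cos p * Real.cosh s : ℝ) : ℂ) +
      ((-(Real.sin p * Real.sinh s) : ℝ) : ℂ) * Complex.I := by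
    rw [Complex.cos_add_mul_I]
    push_cast
    ring
  rw [h, Complex.norm_add_mul_I]
  refine Real.sqrt_le_iff.2 ⟨(Real.cosh_pos s).le, ?_⟩
  nlinarith [Real.cosh_sq s, Real.sin_sq_add_cos_sq p, sq_nonneg (Real.sin p)]

theorem hyp_mem_sector {a : ℝ} (ha : 0 < a) {p δ : ℝ} (hp : -δ ≤ p) (hp0 : p ≤ 0)
    (hδ0 : 0 < δ) (hδ : δ < Real.pi / 2) (s : ℝ) :
    hyp a (p + s * Complex.I) ∈ sector (Real.pi / 2 + δ) := by
  have hpi := Real.pi_pos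
  rw [mem_sector_iff (by linarith) (by linarith), norm_hyp ha, hyp_re,
    add_comm (Real.pi / 2), Real.cos_add_pi_div_two, mul_assoc]
  refine mul_lt_mul_of_pos_left ?_ ha
  have h1 : -Real.sin δ ≤ Real.sin p := by
    rw [← Real.sin_neg]
    exact Real.sin_le_sin_of_le_of_le_pi_div_two (by linarith) (by linarith) hp
  have h2 := Real.sin_lt_sin_of_lt_of_le_pi_div_two (by linarith) le_rfl hδ
  rw [Real.sin_pi_div_two] at h2
  have h3 := Real.sin_nonneg_of_nonneg_of_le_pi hδ0.le (by linarith)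
  have h4 := Real.neg_one_le_sin p
  nlinarith [Real.one_le_cosh s,
    mul_nonneg (by linarith : 0 ≤ Real.sin p + Real.sin δ) (Real.cosh_pos s).le,
    mul_nonneg h3 (by linarith : 0 ≤ 1 + Real.sin p)]

theorem mul_hyp_re_le {a : ℝ} (ha : 0 < a) {p : ℝ} (hc : 0 ≤ Real.cos p) (z : ℂ) (s : ℝ) :
    (z * hyp a (p + s * Complex.I)).re ≤
      a * z.re - a * (-(z.re * Real.sin p) - |z.im| * Real.cos p) * Real.cosh s := by
  rw [Complex.mul_re, hyp_re, hyp_im]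
  have h1 : -(z.im * Real.sinh s) ≤ |z.im| * Real.cosh s := by
    refine (neg_le_abs _).trans ?_
    rw [abs_mul]
    refine mul_le_mul_of_nonneg_left (abs_le.2 ⟨?_, (Real.sinh_lt_cosh s).le⟩) (abs_nonneg _)
    have := (Real.sinh_lt_cosh (-s)).le
    rw [Real.sinh_neg, Real.cosh_neg] at this
    linarith
  nlinarith [mul_le_mul_of_nonneg_left h1 (mul_nonneg ha.le hc)]

theorem one_add_sq_le_two_mul_cosh (s : ℝ) : 1 + s ^ 2 ≤ 2 * Real.cosh s := by
  have h1 : (s / 2) ^ 2 ≤ Real.sinh (s / 2) ^ 2 := by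
    rw [sq_le_sq, Real.abs_sinh]
    exact Real.self_le_sinh_iff.2 (abs_nonneg _)
  have h2 : Real.cosh s = 1 + 2 * Real.sinh (s / 2) ^ 2 := by
    rw [← mul_div_cancel₀ s two_ne_zero, Real.cosh_two_mul, Real.cosh_sq]
    ring_nf
  linarith

theorem inv_cosh_le (s : ℝ) : (Real.cosh s)⁻¹ ≤ 2 * (1 + s ^ 2)⁻¹ := by
  rw [← div_eq_mul_inv, inv_le_comm₀ (Real.cosh_pos s) (by positivity), inv_div]
  linarith [one_add_sq_le_two_mul_cosh s]

theorem exp_neg_mul_cosh_le {k : ℝ} (hk : 0 < k) (s : ℝ) :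
    Real.exp (-(k * Real.cosh s)) ≤ 2 * k⁻¹ * (1 + s ^ 2)⁻¹ := by
  have hkc : 0 < k * Real.cosh s := mul_pos hk (Real.cosh_pos s)
  rw [Real.exp_neg]
  refine (inv_anti₀ hkc ((lt_add_one _).le.trans (Real.add_one_le_exp _))).trans ?_
  rw [mul_inv, mul_comm 2, mul_assoc]
  exact mul_le_mul_of_nonneg_left (inv_cosh_le s) (inv_pos.2 hk).le

theorem cos_le_norm_one_add {δ : ℝ} (hδ0 : 0 < δ) (hδ : δ < Real.pi / 2) {v : ℂ}
    (hv : v ∈ sector (Real.pi / 2 + δ)) :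
    Real.cos δ ≤ ‖1 + v‖ ∧ Real.cos δ * ‖v‖ ≤ ‖1 + v‖ := by
  have hpi := Real.pi_pos
  rw [mem_sector_iff (by linarith) (by linarith), add_comm (Real.pi / 2),
    Real.cos_add_pi_div_two] at hv
  have hc := Real.cos_pos_of_mem_Ioo ⟨by linarith, hδ⟩
  have hsq : ‖1 + v‖ ^ 2 = 1 + 2 * v.re + ‖v‖ ^ 2 := by
    rw [Complex.sq_norm, Complex.sq_norm, Complex.normSq_apply, Complex.normSq_apply]
    simp only [Complex.add_re, Complex.one_re, Complex.add_im, Complex.one_im]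
    ring
  have htr := Real.sin_sq_add_cos_sq δ
  constructor
  · refine le_of_sq_le_sq ?_ (norm_nonneg _)
    nlinarith [sq_nonneg (‖v‖ - Real.sin δ)]
  · refine le_of_sq_le_sq ?_ (norm_nonneg _)
    nlinarith [sq_nonneg (1 - ‖v‖ * Real.sin δ)]
/-! ### Inverse Laplace integrals along hyperbolas -/

/-- The integrand of the inverse Laplace integral of `F`, pulled back along the maps
`hyp (a j)`. -/
def hypKer {n : ℕ} (F : (Fin n → ℂ) → X) (a : Fin n → ℝ) (z ξ : Fin n → ℂ) : X :=
  (∏ j, (Complex.exp (z j * hyp (a j) (ξ j)) *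
    (a j * Complex.cos (ξ j) / (2 * Real.pi)))) • F fun j => hyp (a j) (ξ j)

/-- The inverse Laplace integral of `F` along hyperbolas with asymptotic angles
`π / 2 + δ j`. -/
def hypInt {n : ℕ} (F : (Fin n → ℂ) → X) (a δ : Fin n → ℝ) (z : Fin n → ℂ) : X :=
  ∫ s : Fin n → ℝ, hypKer F a z fun j => ((-δ j : ℝ) : ℂ) + s j * Complex.I

theorem norm_hypKer_le_of_inv {n : ℕ} {F : (Fin n → ℂ) → X} {a p q : Fin n → ℝ}
    {z : Fin n → ℂ} {s : Fin n → ℝ} {C : ℝ} (ha : ∀ j, 0 < a j)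
    (hp : ∀ j, -(Real.pi / 2) < p j ∧ p j ≤ 0) (hC : 0 ≤ C) (hq : ∀ j, 0 < q j)
    (hqz : ∀ j, q j ≤ -((z j).re * Real.sin (p j)) - |(z j).im| * Real.cos (p j))
    (hF : ‖F fun j => hyp (a j) (p j + s j * Complex.I)‖ ≤
      C * ∏ j, ‖hyp (a j) (p j + s j * Complex.I)‖⁻¹) :
    ‖hypKer F a z fun j => p j + s j * Complex.I‖ ≤
      (C * ∏ j, (Real.exp (a j * (z j).re) * (a j * q j * (1 + Real.sin (p j)))⁻¹)) *
        ∏ j, (1 + s j ^ 2)⁻¹ := by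
  have hpi := Real.pi_gt_three
  rw [hypKer, norm_smul, norm_prod]
  refine (mul_le_mul_of_nonneg_left hF (Finset.prod_nonneg fun j _ => norm_nonneg _)).trans ?_
  rw [mul_left_comm, mul_assoc, ← Finset.prod_mul_distrib, ← Finset.prod_mul_distrib]
  refine mul_le_mul_of_nonneg_left (Finset.prod_le_prod (fun j _ => by positivity)
    fun j _ => ?_) hC
  have h1 := one_add_sin_pos (hp j).1 (hp j).2
  have hc : 0 ≤ Real.cos (p j) :=
    Real.cos_nonneg_of_neg_pi_div_two_le_of_le (hp j).1.le (by linarith [(hp j).2])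
  have hcosh := Real.cosh_pos (s j)
  have hpos : 0 < a j * (1 + Real.sin (p j)) * Real.cosh (s j) :=
    mul_pos (mul_pos (ha j) h1) hcosh
  have hexp : ‖Complex.exp (z j * hyp (a j) (p j + s j * Complex.I))‖ ≤
      Real.exp (a j * (z j).re) * (2 * (a j * q j)⁻¹ * (1 + s j ^ 2)⁻¹) := by
    rw [Complex.norm_exp]
    refine (Real.exp_le_exp.2 ((mul_hyp_re_le (ha j) hc (z j) (s j)).trans
      (sub_le_sub_left (mul_le_mul_of_nonneg_right
        (mul_le_mul_of_nonneg_left (hqz j) (ha j).le) hcosh.le) _))).trans ?_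
    rw [sub_eq_add_neg, Real.exp_add]
    exact mul_le_mul_of_nonneg_left (exp_neg_mul_cosh_le (mul_pos (ha j) (hq j)) _)
      (Real.exp_pos _).le
  have hcos : ‖(a j : ℂ) * Complex.cos (p j + s j * Complex.I) / (2 * Real.pi)‖ ≤
      a j * Real.cosh (s j) / 2 := by
    rw [norm_div, norm_mul, norm_mul, Complex.norm_real, Complex.norm_real, Complex.norm_ofNat,
      Real.norm_of_nonneg (ha j).le, Real.norm_of_nonneg Real.pi_pos.le]
    exact div_le_div₀ (mul_nonneg (ha j).le hcosh.le)
      (mul_le_mul_of_nonneg_left (norm_cos_le_cosh _ _) (ha j).le) two_pos (by linarith)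
  have hinv : ‖hyp (a j) (p j + s j * Complex.I)‖⁻¹ ≤
      (a j * (1 + Real.sin (p j)) * Real.cosh (s j))⁻¹ :=
    inv_anti₀ hpos (le_norm_hyp (ha j) (hp j).1 (hp j).2 _)
  rw [norm_mul]
  have hqj := hq j
  have haj := ha j
  refine (mul_le_mul (mul_le_mul hexp hcos (norm_nonneg _) (by positivity)) hinv
    (by positivity) (by positivity)).trans_eq ?_
  field_simp

theorem norm_hypKer_le_of_inv_sq {n : ℕ} {F : (Fin n → ℂ) → X} {a p t : Fin n → ℝ}
    {s : Fin n → ℝ} {B : ℝ} (ha : ∀ j, 0 < a j) (ht : ∀ j, 0 < t j)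
    (hp : ∀ j, -(Real.pi / 2) < p j ∧ p j ≤ 0) (hB : 0 ≤ B)
    (hF : ‖F fun j => hyp (a j) (p j + s j * Complex.I)‖ ≤
      B * ∏ j, (‖hyp (a j) (p j + s j * Complex.I)‖ ^ 2)⁻¹) :
    ‖hypKer F a (fun j => t j) fun j => p j + s j * Complex.I‖ ≤
      (B * ∏ j, (Real.exp (a j * t j) * (a j * (1 + Real.sin (p j)) ^ 2)⁻¹)) *
        ∏ j, (1 + s j ^ 2)⁻¹ := by
  have hpi := Real.pi_gt_three
  rw [hypKer, norm_smul, norm_prod]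
  refine (mul_le_mul_of_nonneg_left hF (Finset.prod_nonneg fun j _ => norm_nonneg _)).trans ?_
  rw [mul_left_comm, mul_assoc, ← Finset.prod_mul_distrib, ← Finset.prod_mul_distrib]
  refine mul_le_mul_of_nonneg_left (Finset.prod_le_prod (fun j _ => by positivity)
    fun j _ => ?_) hB
  have h1 := one_add_sin_pos (hp j).1 (hp j).2
  have hcosh := Real.cosh_pos (s j)
  have hpos : 0 < a j * (1 + Real.sin (p j)) * Real.cosh (s j) :=
    mul_pos (mul_pos (ha j) h1) hcosh
  have hexp : ‖Complex.exp ((t j : ℂ) * hyp (a j) (p j + s j * Complex.I))‖ ≤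
      Real.exp (a j * t j) := by
    rw [Complex.norm_exp, Complex.re_ofReal_mul, hyp_re, mul_comm]
    refine Real.exp_le_exp.2 (mul_le_mul_of_nonneg_right ?_ (ht j).le)
    have := mul_nonpos_of_nonpos_of_nonneg (sin_nonpos_of_mem (hp j).1 (hp j).2) hcosh.le
    nlinarith [mul_nonneg (ha j).le (neg_nonneg.2 this)]
  have hcos : ‖(a j : ℂ) * Complex.cos (p j + s j * Complex.I) / (2 * Real.pi)‖ ≤
      a j * Real.cosh (s j) / 2 := by
    rw [norm_div, norm_mul, norm_mul, Complex.norm_real, Complex.norm_real, Complex.norm_ofNat,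
      Real.norm_of_nonneg (ha j).le, Real.norm_of_nonneg Real.pi_pos.le]
    exact div_le_div₀ (mul_nonneg (ha j).le hcosh.le)
      (mul_le_mul_of_nonneg_left (norm_cos_le_cosh _ _) (ha j).le) two_pos (by linarith)
  have hinv : (‖hyp (a j) (p j + s j * Complex.I)‖ ^ 2)⁻¹ ≤
      ((a j * (1 + Real.sin (p j)) * Real.cosh (s j)) ^ 2)⁻¹ :=
    inv_anti₀ (by positivity) (pow_le_pow_left₀ hpos.le (le_norm_hyp (ha j) (hp j).1 (hp j).2 _) 2)
  rw [norm_mul]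
  have haj := ha j
  refine (mul_le_mul (mul_le_mul hexp hcos (norm_nonneg _) (by positivity)) hinv
    (by positivity) (by positivity)).trans ?_
  have : Real.exp (a j * t j) * (a j * Real.cosh (s j) / 2) *
      ((a j * (1 + Real.sin (p j)) * Real.cosh (s j)) ^ 2)⁻¹ =
      Real.exp (a j * t j) * (a j * (1 + Real.sin (p j)) ^ 2)⁻¹ * ((Real.cosh (s j))⁻¹ / 2) := by
    field_simp
  rw [this]
  exact mul_le_mul_of_nonneg_left (by linarith [inv_cosh_le (s j)]) (by positivity)

theorem differentiableOn_hypKer {n : ℕ} {F : (Fin n → ℂ) → X} {δ : Fin n → ℝ}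
    (hF : DifferentiableOn ℂ F {lam | ∀ j, lam j ∈ sector (Real.pi / 2 + δ j)})
    (a : Fin n → ℝ) :
    DifferentiableOn ℂ (fun w : (Fin n → ℂ) × (Fin n → ℂ) => hypKer F a w.1 w.2)
      {w | ∀ j, hyp (a j) (w.2 j) ∈ sector (Real.pi / 2 + δ j)} := by
  refine DifferentiableOn.smul (Differentiable.differentiableOn ?_)
    (hF.comp (Differentiable.differentiableOn (differentiable_pi.2 fun j => ?_)) fun w hw => hw)
  · simp only [hyp]
    fun_prop
  · simp only [hyp]
    fun_prop

section HypInt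

variable {n : ℕ} {F : (Fin n → ℂ) → X} {a δ : Fin n → ℝ} {C : ℝ}

theorem one_sub_sin_pos {δ : ℝ} (hδ0 : 0 < δ) (hδ : δ < Real.pi / 2) :
    0 < 1 - Real.sin δ := by
  have := one_add_sin_pos (neg_lt_neg hδ) (neg_nonpos.2 hδ0.le)
  rwa [Real.sin_neg, ← sub_eq_add_neg] at this

theorem nonneg_of_inv_bound (hδ : ∀ j, 0 < δ j)
    (hC : ∀ lam : Fin n → ℂ, (∀ j, lam j ∈ sector (Real.pi / 2 + δ j)) →
      ‖F lam‖ ≤ C * ∏ j, ‖lam j‖⁻¹) : 0 ≤ C := by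
  simpa using (norm_nonneg _).trans (hC (fun _ => ((1 : ℝ) : ℂ)) fun j =>
    ofReal_mem_sector (by linarith [hδ j, Real.pi_pos]) one_pos)

theorem hyp_neg_mem_sector (hδ : ∀ j, 0 < δ j ∧ δ j < Real.pi / 2) (ha : ∀ j, 0 < a j)
    (s : Fin n → ℝ) (j : Fin n) :
    hyp (a j) (((-δ j : ℝ) : ℂ) + s j * Complex.I) ∈ sector (Real.pi / 2 + δ j) :=
  hyp_mem_sector (ha j) le_rfl (by linarith [(hδ j).1]) (hδ j).1 (hδ j).2 _

theorem aestronglyMeasurable_hypKer (hδ : ∀ j, 0 < δ j ∧ δ j < Real.pi / 2)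
    (ha : ∀ j, 0 < a j)
    (hF : DifferentiableOn ℂ F {lam | ∀ j, lam j ∈ sector (Real.pi / 2 + δ j)})
    (z : Fin n → ℂ) :
    AEStronglyMeasurable fun s : Fin n → ℝ =>
      hypKer F a z fun j => ((-δ j : ℝ) : ℂ) + s j * Complex.I := by
  refine Continuous.aestronglyMeasurable ((differentiableOn_hypKer hF a).continuousOn.comp_continuous
    (f := fun s : Fin n → ℝ => (z, fun j => ((-δ j : ℝ) : ℂ) + s j * Complex.I)) (by fun_prop) ?_)
  exact hyp_neg_mem_sector hδ ha

theorem re_mul_sin_sub_im_mul_cos {z : ℂ} {δ : ℝ} :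
    z.re * Real.sin δ - |z.im| * Real.cos δ = ‖z‖ * Real.sin (δ - |z.arg|) := by
  have h1 : |z.im| = ‖z‖ * Real.sin |z.arg| := by
    rw [← Complex.norm_mul_sin_arg, abs_mul, abs_norm, Real.abs_sin_eq_sin_abs_of_abs_le_pi
      (Complex.abs_arg_le_pi z)]
  rw [h1, Real.sin_sub, Real.cos_abs, ← Complex.norm_mul_cos_arg]
  ring

theorem sin_sub_pos {γ δ : ℝ} (hγ : 0 ≤ γ) (hδ : γ < δ) (hδ' : δ < Real.pi / 2) :
    0 < Real.sin (δ - γ) :=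
  Real.sin_pos_of_pos_of_lt_pi (by linarith) (by linarith [Real.pi_pos])

theorem norm_hypKer_neg_le (hδ : ∀ j, 0 < δ j ∧ δ j < Real.pi / 2) (ha : ∀ j, 0 < a j)
    (hC : ∀ lam : Fin n → ℂ, (∀ j, lam j ∈ sector (Real.pi / 2 + δ j)) →
      ‖F lam‖ ≤ C * ∏ j, ‖lam j‖⁻¹) {z : Fin n → ℂ} {q : Fin n → ℝ} (hq : ∀ j, 0 < q j)
    (hqz : ∀ j, q j ≤ (z j).re * Real.sin (δ j) - |(z j).im| * Real.cos (δ j))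
    (s : Fin n → ℝ) :
    ‖hypKer F a z fun j => ((-δ j : ℝ) : ℂ) + s j * Complex.I‖ ≤
      (C * ∏ j, (Real.exp (a j * (z j).re) * (a j * q j * (1 - Real.sin (δ j)))⁻¹)) *
        ∏ j, (1 + s j ^ 2)⁻¹ := by
  have hC0 := nonneg_of_inv_bound (fun j => (hδ j).1) hC
  have := norm_hypKer_le_of_inv (F := F) (p := fun j => -δ j) (s := s) (z := z) (C := C) ha
    (fun j => ⟨neg_lt_neg (hδ j).2, neg_nonpos.2 (hδ j).1.le⟩) hC0 hq
    (fun j => by simpa [Real.sin_neg, Real.cos_neg] using hqz j)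
    (hC _ (hyp_neg_mem_sector hδ ha s))
  simpa only [Real.sin_neg, ← sub_eq_add_neg] using this

theorem differentiableOn_hypInt (hδ : ∀ j, 0 < δ j ∧ δ j < Real.pi / 2) (ha : ∀ j, 0 < a j)
    (hF : DifferentiableOn ℂ F {lam | ∀ j, lam j ∈ sector (Real.pi / 2 + δ j)})
    (hC : ∀ lam : Fin n → ℂ, (∀ j, lam j ∈ sector (Real.pi / 2 + δ j)) →
      ‖F lam‖ ≤ C * ∏ j, ‖lam j‖⁻¹) :
    DifferentiableOn ℂ (hypInt F a δ) {z | ∀ j, z j ∈ sector (δ j)} := by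
  have hδπ : ∀ j, δ j ≤ Real.pi := fun j => by linarith [(hδ j).2, Real.pi_pos]
  have hO := isOpen_setOf_forall_mem_sector (fun j => (hδ j).1) hδπ
  refine differentiableOn_integral_of_locally_dominated hO
    (K := fun z (s : Fin n → ℝ) =>
      hypKer F a z fun j => ((-δ j : ℝ) : ℂ) + s j * Complex.I) ?_ ?_ ?_
  · refine Eventually.of_forall fun s => ?_
    refine (differentiableOn_hypKer hF a).comp (f := fun z : Fin n → ℂ =>
      (z, fun j => ((-δ j : ℝ) : ℂ) + s j * Complex.I)) (by fun_prop) fun z _ => ?_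
    exact hyp_neg_mem_sector hδ ha s
  · exact fun z _ => aestronglyMeasurable_hypKer hδ ha hF z
  · intro z hz
    have hq : ∀ j, 0 < (z j).re * Real.sin (δ j) - |(z j).im| * Real.cos (δ j) := fun j => by
      rw [re_mul_sin_sub_im_mul_cos]
      exact mul_pos (norm_pos_iff.2 (hz j).1) (sin_sub_pos (abs_nonneg _) (hz j).2 (hδ j).2)
    set q : Fin n → ℝ := fun j =>
      ((z j).re * Real.sin (δ j) - |(z j).im| * Real.cos (δ j)) / 2 with hqdef
    have hq0 : ∀ j, 0 < q j := fun j => half_pos (hq j)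
    set M : Fin n → ℝ := fun j => (z j).re + 1 with hM
    have hC0 := nonneg_of_inv_bound (fun j => (hδ j).1) hC
    refine ⟨fun s => (C * ∏ j, (Real.exp (a j * M j) *
      (a j * q j * (1 - Real.sin (δ j)))⁻¹)) * ∏ j, (1 + s j ^ 2)⁻¹,
      (integrable_prod_inv_one_add_sq n).const_mul _,
      {w | ∀ j, q j < (w j).re * Real.sin (δ j) - |(w j).im| * Real.cos (δ j) ∧
        (w j).re < M j}, ?_, ?_⟩
    · refine IsOpen.mem_nhds ?_ fun j => ⟨half_lt_self (hq j), lt_add_one _⟩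
      simp only [ofPred_forall, ofPred_and]
      exact isOpen_iInter_of_finite fun j => (isOpen_lt continuous_const (by fun_prop)).inter
        (isOpen_lt (by fun_prop) continuous_const)
    · refine Eventually.of_forall fun s w hw => ?_
      refine (norm_hypKer_neg_le hδ ha hC hq0 (fun j => (hw j).1.le) s).trans ?_
      refine mul_le_mul_of_nonneg_right (mul_le_mul_of_nonneg_left ?_ hC0)
        (Finset.prod_nonneg fun j _ => by positivity)
      have hs := fun j => one_sub_sin_pos (hδ j).1 (hδ j).2
      refine Finset.prod_le_prod (fun j _ => ?_) fun j _ => ?_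
      all_goals
        have h1 := hs j
        have h2 := ha j
        have h3 := hq0 j
      · positivity
      · exact mul_le_mul_of_nonneg_right (Real.exp_le_exp.2
          (mul_le_mul_of_nonneg_left (hw j).2.le h2.le)) (by positivity)

/-- A bound for the inverse Laplace integral along hyperbolas adapted to the point `z`. -/
theorem norm_hypInt_le (hδ : ∀ j, 0 < δ j ∧ δ j < Real.pi / 2)
    (hC : ∀ lam : Fin n → ℂ, (∀ j, lam j ∈ sector (Real.pi / 2 + δ j)) →
      ‖F lam‖ ≤ C * ∏ j, ‖lam j‖⁻¹) {γ : Fin n → ℝ} (hγ : ∀ j, 0 ≤ γ j ∧ γ j < δ j)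
    {z : Fin n → ℂ} (hz : ∀ j, z j ≠ 0 ∧ |(z j).arg| ≤ γ j) :
    ‖hypInt F (fun j => ‖z j‖⁻¹) δ z‖ ≤
      (C * ∏ j, (Real.exp 1 * (Real.sin (δ j - γ j) * (1 - Real.sin (δ j)))⁻¹)) *
        ∫ s : Fin n → ℝ, ∏ j, (1 + s j ^ 2)⁻¹ := by
  have hn : ∀ j, 0 < ‖z j‖ := fun j => norm_pos_iff.2 (hz j).1
  have ha : ∀ j, 0 < ‖z j‖⁻¹ := fun j => inv_pos.2 (hn j)
  have hsin : ∀ j, 0 < Real.sin (δ j - γ j) := fun j =>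
    sin_sub_pos (hγ j).1 (hγ j).2 (hδ j).2
  have hC0 := nonneg_of_inv_bound (fun j => (hδ j).1) hC
  rw [hypInt, ← integral_const_mul]
  refine norm_integral_le_of_norm_le ((integrable_prod_inv_one_add_sq n).const_mul _)
    (Eventually.of_forall fun s => ?_)
  refine (norm_hypKer_neg_le hδ ha hC (q := fun j => ‖z j‖ * Real.sin (δ j - γ j))
    (fun j => mul_pos (hn j) (hsin j)) (fun j => ?_) s).trans ?_
  · rw [re_mul_sin_sub_im_mul_cos]
    refine mul_le_mul_of_nonneg_left (Real.sin_le_sin_of_le_of_le_pi_div_two ?_ ?_ ?_) (hn j).le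
    · linarith [(hγ j).2, (hδ j).1, Real.pi_pos]
    · linarith [(hδ j).2, abs_nonneg (z j).arg]
    · linarith [(hz j).2]
  · refine mul_le_mul_of_nonneg_right (mul_le_mul_of_nonneg_left ?_ hC0)
      (Finset.prod_nonneg fun j _ => by positivity)
    have hs := fun j => one_sub_sin_pos (hδ j).1 (hδ j).2
    refine Finset.prod_le_prod (fun j _ => ?_) fun j _ => ?_
    all_goals
      have h1 := hs j
      have h2 := hn j
      have h3 := hsin j
    · positivity
    · rw [← mul_assoc, inv_mul_cancel₀ h2.ne', one_mul]
      refine mul_le_mul_of_nonneg_right (Real.exp_le_exp.2 ?_) (by positivity)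
      rw [inv_mul_le_iff₀ h2, mul_one]
      exact (le_abs_self _).trans (Complex.abs_re_le_norm _)

/-- Continuity of `hypInt F a δ z` in `F`. -/
theorem tendsto_hypInt (hδ : ∀ j, 0 < δ j ∧ δ j < Real.pi / 2) (ha : ∀ j, 0 < a j)
    {G : ℕ → (Fin n → ℂ) → X}
    (hG : ∀ m, DifferentiableOn ℂ (G m) {lam | ∀ j, lam j ∈ sector (Real.pi / 2 + δ j)})
    (hC : ∀ m, ∀ lam : Fin n → ℂ, (∀ j, lam j ∈ sector (Real.pi / 2 + δ j)) →
      ‖G m lam‖ ≤ C * ∏ j, ‖lam j‖⁻¹)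
    (hGF : ∀ lam : Fin n → ℂ, (∀ j, lam j ∈ sector (Real.pi / 2 + δ j)) →
      Tendsto (fun m => G m lam) atTop (𝓝 (F lam)))
    {z : Fin n → ℂ} (hz : ∀ j, z j ∈ sector (δ j)) :
    Tendsto (fun m => hypInt (G m) a δ z) atTop (𝓝 (hypInt F a δ z)) := by
  have hq : ∀ j, 0 < (z j).re * Real.sin (δ j) - |(z j).im| * Real.cos (δ j) := fun j => by
    rw [re_mul_sin_sub_im_mul_cos]
    exact mul_pos (norm_pos_iff.2 (hz j).1) (sin_sub_pos (abs_nonneg _) (hz j).2 (hδ j).2)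
  refine tendsto_integral_of_dominated_convergence _
    (fun m => aestronglyMeasurable_hypKer hδ ha (hG m) z)
    ((integrable_prod_inv_one_add_sq n).const_mul _)
    (fun m => Eventually.of_forall (norm_hypKer_neg_le hδ ha (hC m) hq fun j => le_rfl))
    (Eventually.of_forall fun s => ?_)
  exact (hGF _ (hyp_neg_mem_sector hδ ha s)).const_smul _

end HypInt
/-! ### Inverse Laplace integrals along vertical lines -/

open scoped FourierTransform in
/-- Fourier inversion at the origin. -/
theorem integral_integral_exp_smul [CompleteSpace X] {n : ℕ} {H : (Fin n → ℝ) → X}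
    (hc : Continuous H) (hi : Integrable H)
    (hi' : Integrable fun w : Fin n → ℝ =>
      ∫ v, Complex.exp ((2 * Real.pi * ∑ j, v j * w j : ℝ) * Complex.I) • H v) :
    ∫ w : Fin n → ℝ, ∫ v : Fin n → ℝ,
      Complex.exp ((2 * Real.pi * ∑ j, v j * w j : ℝ) * Complex.I) • H v = H 0 := by
  have hmp := PiLp.volume_preserving_ofLp (Fin n)
  have hme : MeasurableEmbedding (WithLp.ofLp : EuclideanSpace ℝ (Fin n) → Fin n → ℝ) :=
    (MeasurableEquiv.toLp 2 (Fin n → ℝ)).symm.measurableEmbedding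
  set f : EuclideanSpace ℝ (Fin n) → X := fun v => H v.ofLp with hf
  have hfi : Integrable f := (hmp.integrable_comp_emb hme).2 hi
  have hinv : 𝓕⁻ f = fun w : EuclideanSpace ℝ (Fin n) =>
      ∫ v : Fin n → ℝ, Complex.exp ((2 * Real.pi * ∑ j, v j * w j : ℝ) * Complex.I) • H v := by
    funext w
    rw [Real.fourierInv_eq', ← hmp.integral_comp hme]
    simp only [hf, PiLp.inner_apply, RCLike.inner_apply, conj_trivial, mul_comm]
  have hinvi : Integrable (𝓕⁻ f) := by
    rw [hinv]
    exact (hmp.integrable_comp_emb hme).2 hi'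
  have hfour : Integrable (𝓕 f) := by
    have : 𝓕 f = fun w => 𝓕⁻ f (-w) := by
      funext w
      rw [Real.fourierInv_eq_fourier_neg, neg_neg]
    rw [this]
    exact hinvi.comp_neg
  have key := hfi.fourier_fourierInv_eq hfour (v := 0)
    (hc.comp (PiLp.continuous_ofLp 2 _)).continuousAt
  rw [Real.fourier_eq'] at key
  simp only [inner_zero_right, mul_zero, Complex.ofReal_zero, zero_mul, Complex.exp_zero,
    one_smul] at key
  rw [hinv] at key
  rw [← hmp.integral_comp hme]
  exact key

/-- The integrand of the inverse Laplace integral. -/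
def vertKer {n : ℕ} (G : (Fin n → ℂ) → X) (t : Fin n → ℝ) (lam : Fin n → ℂ) : X :=
  Complex.exp (∑ j, lam j * t j) • G lam

/-- The inverse Laplace integral along the vertical lines through `a`. -/
def vertInt {n : ℕ} (G : (Fin n → ℂ) → X) (a t : Fin n → ℝ) : X :=
  ∫ y : Fin n → ℝ, vertKer G t fun j => a j + 2 * Real.pi * y j * Complex.I

section VertInt

variable {n : ℕ} {G : (Fin n → ℂ) → X} {B : ℝ}

theorem norm_vertKer_le
    (hB : ∀ lam : Fin n → ℂ, (∀ j, 0 < (lam j).re) → ‖G lam‖ ≤ B * ∏ j, (‖lam j‖ ^ 2)⁻¹)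
    (t : Fin n → ℝ) {lam : Fin n → ℂ} (hlam : ∀ j, 0 < (lam j).re) :
    ‖vertKer G t lam‖ ≤ Real.exp (∑ j, (lam j).re * t j) * (B * ∏ j, (‖lam j‖ ^ 2)⁻¹) := by
  rw [vertKer, norm_smul, Complex.norm_exp, Complex.re_sum]
  simp only [Complex.re_mul_ofReal]
  exact mul_le_mul_of_nonneg_left (hB lam hlam) (Real.exp_pos _).le

theorem re_vertical (a y : ℝ) : ((a : ℂ) + 2 * Real.pi * y * Complex.I).re = a := by
  simp

theorem sq_norm_vertical (a y : ℝ) :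
    ‖(a : ℂ) + 2 * Real.pi * y * Complex.I‖ ^ 2 = a ^ 2 + (2 * Real.pi * y) ^ 2 := by
  rw [Complex.sq_norm, Complex.normSq_apply]
  simp
  ring

theorem nonneg_of_sq_bound {Y : Type*} [NormedAddCommGroup Y] {G : (Fin n → ℂ) → Y}
    (hB : ∀ lam : Fin n → ℂ, (∀ j, 0 < (lam j).re) → ‖G lam‖ ≤ B * ∏ j, (‖lam j‖ ^ 2)⁻¹) :
    0 ≤ B := by
  simpa using (norm_nonneg _).trans (hB (fun _ => 1) fun _ => by simp)

theorem two_pi_mul_sq_ge (y : ℝ) : y ^ 2 ≤ (2 * Real.pi * y) ^ 2 := by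
  rw [mul_pow]
  exact le_mul_of_one_le_left (sq_nonneg y) (by nlinarith [Real.pi_gt_three])

/-- The inverse Laplace integral does not depend on the abscissa of integration. -/
theorem vertInt_eq_vertInt
    (hG : DifferentiableOn ℂ G {lam | ∀ j, 0 < (lam j).re})
    (hB : ∀ lam : Fin n → ℂ, (∀ j, 0 < (lam j).re) → ‖G lam‖ ≤ B * ∏ j, (‖lam j‖ ^ 2)⁻¹)
    {a a' : Fin n → ℝ} (ha : ∀ j, 0 < a j) (ha' : ∀ j, 0 < a' j) (t : Fin n → ℝ) :
    vertInt G a t = vertInt G a' t := by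
  have hpi := Real.pi_pos
  have hB0 := nonneg_of_sq_bound hB
  set K : (Fin n → ℂ) → X := fun ξ => vertKer G t fun j => 2 * Real.pi * ξ j with hK
  set p : (Fin n → ℝ) → Fin n → ℝ := fun b j => b j / (2 * Real.pi) with hp
  have hpK : ∀ b s : Fin n → ℝ, K (fun j => (p b j : ℂ) + s j * Complex.I) =
      vertKer G t fun j => (b j : ℂ) + 2 * Real.pi * s j * Complex.I := by
    intro b s
    simp only [hK, hp]
    congr 1
    funext j
    have : (Real.pi : ℂ) ≠ 0 := by exact_mod_cast hpi.ne'
    push_cast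
    field_simp
  have hint : ∀ b, vertInt G b t = ∫ s : Fin n → ℝ, K fun j => (p b j : ℂ) + s j * Complex.I := by
    intro b
    simp only [hpK, vertInt]
  set r : Fin n → ℝ := fun j => min (a j) (a' j) with hr
  have hr0 : ∀ j, 0 < r j := fun j => lt_min (ha j) (ha' j)
  set c : ℝ → Fin n → ℝ := fun x j => a j + x * (a' j - a j) with hc
  have hc1 : ∀ x ∈ Icc (0 : ℝ) 1, ∀ j, r j ≤ c x j := by
    intro x hx j
    have h1 := min_le_left (a j) (a' j)
    have h2 := min_le_right (a j) (a' j)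
    have : c x j = (1 - x) * a j + x * a' j := by
      simp only [hc]
      ring
    rw [this]
    nlinarith [mul_le_mul_of_nonneg_left h1 (sub_nonneg.2 hx.2),
      mul_le_mul_of_nonneg_left h2 hx.1]
  have hc2 : ∀ x ∈ Icc (0 : ℝ) 1, ∀ j, c x j ≤ a j + a' j := by
    intro x hx j
    simp only [hc]
    nlinarith [mul_nonneg hx.1 (ha j).le, mul_nonneg (sub_nonneg.2 hx.2) (ha' j).le]
  have hpc : ∀ (x : ℝ) (s : Fin n → ℝ), (fun j => ((p a j + x * (p a' j - p a j) : ℝ) : ℂ) + s j * Complex.I) =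
      fun j : Fin n => (p (c x) j : ℂ) + s j * Complex.I := by
    intro x s
    funext j
    simp only [hp, hc]
    congr 2
    ring
  rw [hint, hint]
  have key := integral_vertical_shift (K := K) (D := {ξ | ∀ j, 0 < (ξ j).re}) (p := p a)
    (d := fun j => p a' j - p a j)
    (B := Real.exp (∑ j, (a j + a' j) * |t j|) * (B * ∏ j, (min 1 (r j ^ 2))⁻¹)) ?_ ?_ ?_
  · simpa only [add_sub_cancel] using key
  · refine DifferentiableOn.smul (Differentiable.differentiableOn (by fun_prop))
      (hG.comp (Differentiable.differentiableOn (by fun_prop)) fun ξ hξ j => ?_)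
    have : (2 * (Real.pi : ℂ) * ξ j).re = 2 * Real.pi * (ξ j).re := by simp
    rw [this]
    exact mul_pos (mul_pos two_pos hpi) (hξ j)
  · intro x hx s
    rw [hpc]
    intro j
    simp only [Complex.add_re, Complex.ofReal_re, Complex.mul_re, Complex.I_re, Complex.ofReal_im,
      mul_zero, zero_mul, sub_zero, add_zero]
    exact div_pos ((hr0 j).trans_le (hc1 x hx j)) (by positivity)
  · intro x hx s
    rw [hpc, hpK]
    have hcx : ∀ j, 0 < c x j := fun j => (hr0 j).trans_le (hc1 x hx j)
    refine (norm_vertKer_le hB t fun j => by rw [re_vertical]; exact hcx j).trans ?_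
    rw [mul_assoc, mul_assoc, ← Finset.prod_mul_distrib]
    refine mul_le_mul (Real.exp_le_exp.2 (Finset.sum_le_sum fun j _ => ?_))
      (mul_le_mul_of_nonneg_left (Finset.prod_le_prod (fun j _ => by positivity)
        fun j _ => ?_) hB0) (mul_nonneg hB0 (Finset.prod_nonneg fun j _ => by positivity))
      (Real.exp_pos _).le
    · rw [re_vertical]
      exact (mul_le_mul_of_nonneg_left (le_abs_self _) (hcx j).le).trans
        (mul_le_mul_of_nonneg_right (hc2 x hx j) (abs_nonneg _))
    · have hm : 0 < min 1 (r j ^ 2) := lt_min one_pos (pow_pos (hr0 j) 2)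
      rw [sq_norm_vertical, ← mul_inv]
      refine inv_anti₀ (by positivity) ?_
      have h1 := min_le_left 1 (r j ^ 2)
      have h2 := min_le_right 1 (r j ^ 2)
      have h3 := pow_le_pow_left₀ (hr0 j).le (hc1 x hx j) 2
      nlinarith [two_pi_mul_sq_ge (s j), mul_le_mul_of_nonneg_right h1 (sq_nonneg (s j))]

theorem norm_vertKer_mul_le
    (hB : ∀ lam : Fin n → ℂ, (∀ j, 0 < (lam j).re) → ‖G lam‖ ≤ B * ∏ j, (‖lam j‖ ^ 2)⁻¹)
    {a : Fin n → ℝ} (ha : ∀ j, 0 < a j) (t s : Fin n → ℝ) :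
    ‖vertKer G t fun j => (a j : ℂ) + 2 * Real.pi * (a j * s j : ℝ) * Complex.I‖ ≤
      Real.exp (∑ j, a j * t j) * (B * ∏ j, (a j ^ 2)⁻¹) * ∏ j, (1 + s j ^ 2)⁻¹ := by
  have hB0 := nonneg_of_sq_bound hB
  refine (norm_vertKer_le hB t fun j => by rw [re_vertical]; exact ha j).trans ?_
  simp only [re_vertical, sq_norm_vertical]
  rw [mul_assoc, mul_assoc, ← Finset.prod_mul_distrib]
  refine mul_le_mul_of_nonneg_left (mul_le_mul_of_nonneg_left (Finset.prod_le_prod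
    (fun j _ => by positivity) fun j _ => ?_) hB0) (Real.exp_pos _).le
  rw [← mul_inv]
  have haj := ha j
  refine inv_anti₀ (by positivity) ?_
  nlinarith [two_pi_mul_sq_ge (a j * s j)]

theorem norm_vertInt_le
    (hB : ∀ lam : Fin n → ℂ, (∀ j, 0 < (lam j).re) → ‖G lam‖ ≤ B * ∏ j, (‖lam j‖ ^ 2)⁻¹)
    {a : Fin n → ℝ} (ha : ∀ j, 0 < a j) (t : Fin n → ℝ) :
    ‖vertInt G a t‖ ≤ Real.exp (∑ j, a j * t j) *
      (B * (∏ j, (a j)⁻¹) * ∫ s : Fin n → ℝ, ∏ j, (1 + s j ^ 2)⁻¹) := by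
  have hA : 0 < ∏ j, a j := Finset.prod_pos fun j _ => ha j
  rw [vertInt, ← integral_comp_separable (g := fun j x => a j * x) (g' := fun j _ => a j)
    (fun j x => by simpa using (hasDerivAt_id x).const_mul (a j))
    (fun j => (Equiv.mulLeft₀ (a j) (ha j).ne').bijective)]
  have h : Real.exp (∑ j, a j * t j) *
      (B * (∏ j, (a j)⁻¹) * ∫ s : Fin n → ℝ, ∏ j, (1 + s j ^ 2)⁻¹) =
      ∫ s : Fin n → ℝ, (∏ j, a j) * (Real.exp (∑ j, a j * t j) * (B * ∏ j, (a j ^ 2)⁻¹) *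
        ∏ j, (1 + s j ^ 2)⁻¹) := by
    rw [integral_const_mul, integral_const_mul, Finset.prod_inv_distrib, Finset.prod_inv_distrib,
      Finset.prod_pow]
    field_simp
  rw [h]
  refine norm_integral_le_of_norm_le
    (((integrable_prod_inv_one_add_sq n).const_mul _).const_mul _)
    (Eventually.of_forall fun s => ?_)
  rw [norm_smul, Real.norm_of_nonneg (abs_nonneg _), abs_of_pos hA]
  exact mul_le_mul_of_nonneg_left (norm_vertKer_mul_le hB ha t s) hA.le

theorem vertInt_eq_zero
    (hG : DifferentiableOn ℂ G {lam | ∀ j, 0 < (lam j).re})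
    (hB : ∀ lam : Fin n → ℂ, (∀ j, 0 < (lam j).re) → ‖G lam‖ ≤ B * ∏ j, (‖lam j‖ ^ 2)⁻¹)
    {a : Fin n → ℝ} (ha : ∀ j, 0 < a j) {t : Fin n → ℝ} (ht : ¬∀ j, 0 < t j) :
    vertInt G a t = 0 := by
  obtain ⟨i, hi⟩ := not_forall.1 ht
  rw [not_lt] at hi
  have hB0 := nonneg_of_sq_bound hB
  set M : ℝ := Real.exp (∑ j, |t j|) * (B * ∫ s : Fin n → ℝ, ∏ j, (1 + s j ^ 2)⁻¹)
  have hI : 0 ≤ ∫ s : Fin n → ℝ, ∏ j, (1 + s j ^ 2)⁻¹ :=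
    integral_nonneg fun s => Finset.prod_nonneg fun j _ => by positivity
  have hle : ∀ A : ℝ, 0 < A → ‖vertInt G a t‖ ≤ M * A⁻¹ := by
    intro A hA
    set b : Fin n → ℝ := Function.update (fun _ => 1) i A with hb
    have hbi : b i = A := by simp [hb]
    have hbj : ∀ j, j ≠ i → b j = 1 := fun j hj => by simp [hb, hj]
    have hb0 : ∀ j, 0 < b j := fun j => by
      by_cases h : j = i
      · rw [h, hbi]
        exact hA
      · rw [hbj j h]
        exact one_pos
    rw [vertInt_eq_vertInt hG hB ha hb0]
    refine (norm_vertInt_le hB hb0 t).trans ?_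
    have hprod : ∏ j, (b j)⁻¹ = A⁻¹ := by
      rw [Finset.prod_eq_single i (fun j _ hj => by rw [hbj j hj, inv_one]) (by simp), hbi]
    have hsum : ∑ j, b j * t j ≤ ∑ j, |t j| := by
      refine Finset.sum_le_sum fun j _ => ?_
      by_cases h : j = i
      · rw [h, hbi]
        exact (mul_nonpos_of_nonneg_of_nonpos hA.le hi).trans (abs_nonneg _)
      · rw [hbj j h, one_mul]
        exact le_abs_self _
    rw [hprod]
    have h1 := Real.exp_le_exp.2 hsum
    have h2 : 0 ≤ B * A⁻¹ * ∫ s : Fin n → ℝ, ∏ j, (1 + s j ^ 2)⁻¹ := by positivity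
    refine (mul_le_mul_of_nonneg_right h1 h2).trans_eq ?_
    simp only [M]
    ring
  have hlim : Tendsto (fun A : ℝ => M * A⁻¹) atTop (𝓝 0) := by
    simpa using tendsto_inv_atTop_zero.const_mul M
  refine norm_le_zero_iff.1 (ge_of_tendsto hlim ?_)
  filter_upwards [eventually_gt_atTop 0] with A hA using hle A hA

theorem continuous_comp_vertical {K : (Fin n → ℂ) → X}
    (hK : DifferentiableOn ℂ K {lam | ∀ j, 0 < (lam j).re}) {a : Fin n → ℝ}
    (ha : ∀ j, 0 < a j) :
    Continuous fun y : Fin n → ℝ => K fun j => (a j : ℂ) + 2 * Real.pi * y j * Complex.I := by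
  refine hK.continuousOn.comp_continuous (by fun_prop) fun y j => ?_
  rw [re_vertical]
  exact ha j

/-- The Laplace transform inverts the inverse Laplace integral. -/
theorem setIntegral_exp_smul_vertInt [CompleteSpace X]
    (hG : DifferentiableOn ℂ G {lam | ∀ j, 0 < (lam j).re})
    (hB : ∀ lam : Fin n → ℂ, (∀ j, 0 < (lam j).re) → ‖G lam‖ ≤ B * ∏ j, (‖lam j‖ ^ 2)⁻¹)
    {b : Fin n → ℝ} (hb : ∀ j, 0 < b j) :
    ∫ t in {t : Fin n → ℝ | ∀ j, 0 < t j},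
      Complex.exp (-(∑ j, (b j : ℂ) * (t j : ℂ))) • vertInt G b t = G fun j => b j := by
  have hB0 := nonneg_of_sq_bound hB
  have hO := measurableSet_setOf_forall_pos n
  set H : (Fin n → ℝ) → X := fun y => G fun j => (b j : ℂ) + 2 * Real.pi * y j * Complex.I with hH
  have hHc : Continuous H := continuous_comp_vertical hG hb
  have hHi : Integrable H := by
    refine ((integrable_prod_inv_one_add_sq n).const_mul
      (B * ∏ j, (min 1 (b j ^ 2))⁻¹)).mono' hHc.aestronglyMeasurable
      (Eventually.of_forall fun s => ?_)
    refine (hB _ fun j => by rw [re_vertical]; exact hb j).trans ?_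
    rw [mul_assoc, ← Finset.prod_mul_distrib]
    refine mul_le_mul_of_nonneg_left (Finset.prod_le_prod (fun j _ => by positivity)
      fun j _ => ?_) hB0
    have hm : 0 < min 1 (b j ^ 2) := lt_min one_pos (pow_pos (hb j) 2)
    rw [sq_norm_vertical, ← mul_inv]
    refine inv_anti₀ (by positivity) ?_
    nlinarith [two_pi_mul_sq_ge (s j), min_le_right 1 (b j ^ 2),
      mul_le_mul_of_nonneg_right (min_le_left 1 (b j ^ 2)) (sq_nonneg (s j))]
  have hV : ∀ t : Fin n → ℝ,
      ∫ v, Complex.exp ((2 * Real.pi * ∑ j, v j * t j : ℝ) * Complex.I) • H v =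
        Complex.exp (-(∑ j, (b j : ℂ) * (t j : ℂ))) • vertInt G b t := by
    intro t
    rw [vertInt, ← integral_smul]
    congr 1
    funext v
    rw [vertKer, smul_smul, ← Complex.exp_add]
    congr 2
    simp only [add_mul, Finset.sum_add_distrib, Finset.mul_sum, Complex.ofReal_sum,
      Finset.sum_mul, Complex.ofReal_mul, Complex.ofReal_ofNat]
    rw [neg_add_cancel_left]
    refine Finset.sum_congr rfl fun j _ => ?_
    ring
  have hcont : Continuous fun t : Fin n → ℝ =>
      Complex.exp (-(∑ j, (b j : ℂ) * (t j : ℂ))) • vertInt G b t := by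
    simp only [← hV]
    refine continuous_of_dominated (bound := fun v => ‖H v‖) (fun t => ?_) (fun t => ?_) hHi.norm ?_
    · exact Continuous.aestronglyMeasurable (by fun_prop)
    · refine Eventually.of_forall fun v => ?_
      rw [norm_smul, Complex.norm_exp_ofReal_mul_I, one_mul]
    · exact Eventually.of_forall fun v => by fun_prop
  have hzero : ∀ t : Fin n → ℝ, t ∉ {t : Fin n → ℝ | ∀ j, 0 < t j} →
      Complex.exp (-(∑ j, (b j : ℂ) * (t j : ℂ))) • vertInt G b t = 0 := by
    intro t ht
    rw [vertInt_eq_zero hG hB hb ht, smul_zero]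
  have hint : Integrable fun t : Fin n → ℝ =>
      Complex.exp (-(∑ j, (b j : ℂ) * (t j : ℂ))) • vertInt G b t := by
    have hb2 : ∀ j, 0 < b j / 2 := fun j => half_pos (hb j)
    rw [← integrableOn_iff_integrable_of_support_subset (s := {t : Fin n → ℝ | ∀ j, 0 < t j})
      fun t ht => by_contra fun h => ht (hzero t h)]
    refine ((integrableOn_prod_exp_neg hb2).const_mul (B * (∏ j, (b j / 2)⁻¹) *
      ∫ s : Fin n → ℝ, ∏ j, (1 + s j ^ 2)⁻¹)).mono' hcont.aestronglyMeasurable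
      (Eventually.of_forall fun t => ?_)
    rw [norm_smul, Complex.norm_exp, vertInt_eq_vertInt hG hB hb hb2]
    refine (mul_le_mul_of_nonneg_left (norm_vertInt_le hB hb2 t) (Real.exp_pos _).le).trans_eq ?_
    rw [← mul_assoc, ← Real.exp_add, mul_comm, ← Real.exp_sum]
    congr 2
    simp only [Complex.neg_re, Complex.re_sum, Complex.re_ofReal_mul, Complex.ofReal_re]
    rw [← Finset.sum_neg_distrib, ← Finset.sum_add_distrib]
    refine Finset.sum_congr rfl fun j _ => ?_
    ring
  rw [setIntegral_eq_integral_of_forall_compl_eq_zero hzero]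
  simp only [← hV] at hint ⊢
  rw [integral_integral_exp_smul hHc hHi hint]
  simp [hH]

end VertInt
/-! ### Holomorphic inverse Laplace transforms -/

theorem mem_sector_of_re_pos {δ : ℝ} (hδ0 : 0 < δ) (hδ : δ < Real.pi / 2) {z : ℂ}
    (hz : 0 < z.re) : z ∈ sector (Real.pi / 2 + δ) := by
  rw [mem_sector_iff (by linarith) (by linarith), add_comm (Real.pi / 2),
    Real.cos_add_pi_div_two]
  have := Real.sin_nonneg_of_nonneg_of_le_pi hδ0.le (by linarith)
  nlinarith [mul_nonneg (norm_nonneg z) this]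

section InverseLaplace

variable {n : ℕ} {F G : (Fin n → ℂ) → X} {a δ : Fin n → ℝ} {B C : ℝ}

theorem integral_hypKer_eq_vertInt (ha : ∀ j, 0 < a j) (t : Fin n → ℝ) :
    ∫ s : Fin n → ℝ, hypKer G a (fun j => (t j : ℂ)) (fun j => ((0 : ℝ) : ℂ) + s j * Complex.I) =
      vertInt G a t := by
  have hpi := Real.pi_pos
  have hπ : (Real.pi : ℂ) ≠ 0 := by exact_mod_cast hpi.ne'
  have hbij : ∀ j, Function.Bijective fun x : ℝ => a j / (2 * Real.pi) * Real.sinh x := fun j =>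
    (Equiv.mulLeft₀ (a j / (2 * Real.pi)) (div_pos (ha j) (by positivity)).ne').bijective.comp
      Real.sinh_bijective
  refine Eq.trans ?_ (integral_comp_separable
    (g' := fun j x => a j / (2 * Real.pi) * Real.cosh x)
    (fun j x => (Real.hasDerivAt_sinh x).const_mul _) hbij _)
  congr 1
  funext s
  have hpath : ∀ j, hyp (a j) (((0 : ℝ) : ℂ) + s j * Complex.I) =
      a j + 2 * Real.pi * ((a j / (2 * Real.pi) * Real.sinh (s j) : ℝ) : ℂ) * Complex.I := by
    intro j
    rw [hyp_eq]
    push_cast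
    simp only [Complex.sin_zero, Complex.cos_zero]
    field_simp
    ring
  have hcos : ∀ j, (a j : ℂ) * Complex.cos (((0 : ℝ) : ℂ) + s j * Complex.I) / (2 * Real.pi) =
      ((a j / (2 * Real.pi) * Real.cosh (s j) : ℝ) : ℂ) := by
    intro j
    rw [Complex.ofReal_zero, zero_add, Complex.cos_mul_I]
    push_cast
    ring
  have habs : |∏ j, a j / (2 * Real.pi) * Real.cosh (s j)| =
      ∏ j, a j / (2 * Real.pi) * Real.cosh (s j) := by
    refine abs_of_nonneg (Finset.prod_nonneg fun j _ => ?_)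
    have := ha j
    have := Real.cosh_pos (s j)
    positivity
  simp only [hypKer, hpath, hcos]
  rw [habs, vertKer, ← Complex.coe_smul, smul_smul, Finset.prod_mul_distrib, ← Complex.exp_sum,
    Complex.ofReal_prod, mul_comm]
  congr 3
  exact Finset.sum_congr rfl fun j _ => mul_comm _ _

theorem hypInt_eq_vertInt (hδ : ∀ j, 0 < δ j ∧ δ j < Real.pi / 2) (ha : ∀ j, 0 < a j)
    (hG : DifferentiableOn ℂ G {lam | ∀ j, lam j ∈ sector (Real.pi / 2 + δ j)})
    (hB : ∀ lam : Fin n → ℂ, (∀ j, lam j ∈ sector (Real.pi / 2 + δ j)) →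
      ‖G lam‖ ≤ B * ∏ j, (‖lam j‖ ^ 2)⁻¹)
    {t : Fin n → ℝ} (ht : ∀ j, 0 < t j) :
    hypInt G a δ (fun j => (t j : ℂ)) = vertInt G a t := by
  have hB0 : 0 ≤ B := nonneg_of_sq_bound fun lam hlam =>
    hB lam fun j => mem_sector_of_re_pos (hδ j).1 (hδ j).2 (hlam j)
  have hpx : ∀ x ∈ Icc (0 : ℝ) 1, ∀ j, -δ j ≤ 0 + x * -δ j ∧ 0 + x * -δ j ≤ 0 := by
    intro x hx j
    constructor <;> nlinarith [(hδ j).1, mul_nonneg hx.1 (hδ j).1.le,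
      mul_nonneg (sub_nonneg.2 hx.2) (hδ j).1.le]
  have hmem : ∀ x ∈ Icc (0 : ℝ) 1, ∀ (s : Fin n → ℝ) j,
      hyp (a j) (((0 + x * -δ j : ℝ) : ℂ) + s j * Complex.I) ∈ sector (Real.pi / 2 + δ j) :=
    fun x hx s j => hyp_mem_sector (ha j) (hpx x hx j).1 (hpx x hx j).2 (hδ j).1 (hδ j).2 _
  have hK : DifferentiableOn ℂ (hypKer G a fun j => (t j : ℂ))
      {ξ | ∀ j, hyp (a j) (ξ j) ∈ sector (Real.pi / 2 + δ j)} :=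
    (differentiableOn_hypKer hG a).comp (f := fun ξ : Fin n → ℂ => ((fun j => (t j : ℂ)), ξ))
      (by fun_prop) fun ξ hξ => hξ
  have key := integral_vertical_shift hK (p := fun _ => 0) (d := fun j => -δ j)
    (B := B * ∏ j, (Real.exp (a j * t j) * (a j * (1 - Real.sin (δ j)) ^ 2)⁻¹))
    (fun x hx s => hmem x hx s) fun x hx s => ?_
  · rw [← integral_hypKer_eq_vertInt ha, key]
    simp only [zero_add, hypInt]
  · have hp : ∀ j, -(Real.pi / 2) < 0 + x * -δ j := fun j =>
      (neg_lt_neg (hδ j).2).trans_le (hpx x hx j).1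
    refine (norm_hypKer_le_of_inv_sq ha ht (fun j => ⟨hp j, (hpx x hx j).2⟩) hB0
      (hB _ (hmem x hx s))).trans ?_
    refine mul_le_mul_of_nonneg_right (mul_le_mul_of_nonneg_left ?_ hB0)
      (Finset.prod_nonneg fun j _ => by positivity)
    refine Finset.prod_le_prod (fun j _ => ?_) fun j _ => ?_
    all_goals have haj := ha j
    · positivity
    · have h1 := one_sub_sin_pos (hδ j).1 (hδ j).2
      refine mul_le_mul_of_nonneg_left (inv_anti₀ (by positivity)
        (mul_le_mul_of_nonneg_left (pow_le_pow_left₀ h1.le ?_ 2) haj.le)) (Real.exp_pos _).le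
      have := Real.sin_le_sin_of_le_of_le_pi_div_two (neg_lt_neg (hδ j).2).le
        (by linarith [(hpx x hx j).2, Real.pi_pos]) (hpx x hx j).1
      rw [Real.sin_neg] at this
      linarith

/-- Regularization of `F` by factors that decay at infinity. -/
def regularize (F : (Fin n → ℂ) → X) (m : ℕ) (lam : Fin n → ℂ) : X :=
  (∏ j, (1 + (((m : ℝ) + 1)⁻¹ : ℝ) * lam j)⁻¹) • F lam

theorem scaled_mem_sector {β : ℝ} {z : ℂ} (hz : z ∈ sector β) (m : ℕ) :
    ((((m : ℝ) + 1)⁻¹ : ℝ) : ℂ) * z ∈ sector β := by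
  rw [mul_comm]
  exact mul_ofReal_mem_sector hz (by positivity)

theorem one_add_scaled_ne_zero {β : ℝ} (hβ0 : 0 < β) (hβ : β < Real.pi / 2) {z : ℂ}
    (hz : z ∈ sector (Real.pi / 2 + β)) (m : ℕ) :
    1 + ((((m : ℝ) + 1)⁻¹ : ℝ) : ℂ) * z ≠ 0 := by
  have := (cos_le_norm_one_add hβ0 hβ (scaled_mem_sector hz m)).1
  exact norm_pos_iff.1 ((Real.cos_pos_of_mem_Ioo ⟨by linarith, hβ⟩).trans_le this)

theorem differentiableOn_regularize (hδ : ∀ j, 0 < δ j ∧ δ j < Real.pi / 2)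
    (hF : DifferentiableOn ℂ F {lam | ∀ j, lam j ∈ sector (Real.pi / 2 + δ j)}) (m : ℕ) :
    DifferentiableOn ℂ (regularize F m) {lam | ∀ j, lam j ∈ sector (Real.pi / 2 + δ j)} := by
  refine DifferentiableOn.smul ?_ hF
  simp only [Finset.prod_inv_distrib]
  refine DifferentiableOn.inv (Differentiable.differentiableOn (by fun_prop)) fun lam hlam => ?_
  exact Finset.prod_ne_zero_iff.2 fun j _ =>
    one_add_scaled_ne_zero (hδ j).1 (hδ j).2 (hlam j) m

theorem norm_regularize_le (hδ : ∀ j, 0 < δ j ∧ δ j < Real.pi / 2)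
    (hC : ∀ lam : Fin n → ℂ, (∀ j, lam j ∈ sector (Real.pi / 2 + δ j)) →
      ‖F lam‖ ≤ C * ∏ j, ‖lam j‖⁻¹) (m : ℕ) {lam : Fin n → ℂ}
    (hlam : ∀ j, lam j ∈ sector (Real.pi / 2 + δ j)) :
    ‖regularize F m lam‖ ≤ ((∏ j, (Real.cos (δ j))⁻¹) * C) * ∏ j, ‖lam j‖⁻¹ := by
  have hcos : ∀ j, 0 < Real.cos (δ j) := fun j =>
    Real.cos_pos_of_mem_Ioo ⟨by linarith [(hδ j).1, (hδ j).2], (hδ j).2⟩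
  rw [regularize, norm_smul, norm_prod, mul_assoc]
  refine mul_le_mul (Finset.prod_le_prod (fun j _ => norm_nonneg _) fun j _ => ?_) (hC lam hlam)
    (norm_nonneg _) (Finset.prod_nonneg fun j _ => (inv_pos.2 (hcos j)).le)
  rw [norm_inv]
  exact inv_anti₀ (hcos j)
    (cos_le_norm_one_add (hδ j).1 (hδ j).2 (scaled_mem_sector (hlam j) m)).1

theorem norm_regularize_le_sq (hδ : ∀ j, 0 < δ j ∧ δ j < Real.pi / 2)
    (hC : ∀ lam : Fin n → ℂ, (∀ j, lam j ∈ sector (Real.pi / 2 + δ j)) →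
      ‖F lam‖ ≤ C * ∏ j, ‖lam j‖⁻¹) (m : ℕ) {lam : Fin n → ℂ}
    (hlam : ∀ j, lam j ∈ sector (Real.pi / 2 + δ j)) :
    ‖regularize F m lam‖ ≤
      ((∏ j, (Real.cos (δ j) * ((m : ℝ) + 1)⁻¹)⁻¹) * C) * ∏ j, (‖lam j‖ ^ 2)⁻¹ := by
  have hm : 0 < ((m : ℝ) + 1)⁻¹ := by positivity
  have hn : ∀ j, 0 < ‖lam j‖ := fun j => norm_pos_iff.2 (hlam j).1
  have hcos : ∀ j, 0 < Real.cos (δ j) := fun j =>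
    Real.cos_pos_of_mem_Ioo ⟨by linarith [(hδ j).1, (hδ j).2], (hδ j).2⟩
  have h1 : ‖∏ j, (1 + (((m : ℝ) + 1)⁻¹ : ℝ) * lam j)⁻¹‖ ≤
      ∏ j, ((Real.cos (δ j) * ((m : ℝ) + 1)⁻¹)⁻¹ * ‖lam j‖⁻¹) := by
    rw [norm_prod]
    refine Finset.prod_le_prod (fun j _ => norm_nonneg _) fun j _ => ?_
    have := (cos_le_norm_one_add (hδ j).1 (hδ j).2 (scaled_mem_sector (hlam j) m)).2
    rw [norm_mul, Complex.norm_real, Real.norm_of_nonneg hm.le, ← mul_assoc] at this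
    rw [norm_inv, ← mul_inv]
    exact inv_anti₀ (mul_pos (mul_pos (hcos j) hm) (hn j)) this
  rw [regularize, norm_smul]
  refine (mul_le_mul h1 (hC lam hlam) (norm_nonneg _) ((norm_nonneg _).trans h1)).trans_eq ?_
  simp only [Finset.prod_mul_distrib, pow_two, mul_inv]
  ring

theorem tendsto_regularize (F : (Fin n → ℂ) → X) (lam : Fin n → ℂ) :
    Tendsto (fun m => regularize F m lam) atTop (𝓝 (F lam)) := by
  have h0 : Tendsto (fun m : ℕ => ((((m : ℝ) + 1)⁻¹ : ℝ) : ℂ)) atTop (𝓝 0) := by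
    have := (Complex.continuous_ofReal.tendsto 0).comp
      (tendsto_one_div_add_atTop_nhds_zero_nat (𝕜 := ℝ))
    simpa [Function.comp_def] using this
  have h1 : Tendsto (fun m : ℕ => ∏ j, (1 + (((m : ℝ) + 1)⁻¹ : ℝ) * lam j)⁻¹) atTop
      (𝓝 (∏ _j : Fin n, 1)) := by
    refine tendsto_finsetProd _ fun j _ => ?_
    have := ((h0.mul_const (lam j)).const_add 1).inv₀ (by simp)
    simpa using this
  simpa [regularize] using h1.smul_const (F lam)

end InverseLaplace

section Independence

variable {n : ℕ} {F : (Fin n → ℂ) → X} {a a' δ δ' : Fin n → ℝ} {C C' : ℝ}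

theorem hypInt_regularize_eq_vertInt (hδ : ∀ j, 0 < δ j ∧ δ j < Real.pi / 2) (ha : ∀ j, 0 < a j)
    (hF : DifferentiableOn ℂ F {lam | ∀ j, lam j ∈ sector (Real.pi / 2 + δ j)})
    (hC : ∀ lam : Fin n → ℂ, (∀ j, lam j ∈ sector (Real.pi / 2 + δ j)) →
      ‖F lam‖ ≤ C * ∏ j, ‖lam j‖⁻¹) {b t : Fin n → ℝ} (hb : ∀ j, 0 < b j)
    (ht : ∀ j, 0 < t j) (m : ℕ) :
    hypInt (regularize F m) a δ (fun j => (t j : ℂ)) = vertInt (regularize F m) b t := by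
  have hs : {lam : Fin n → ℂ | ∀ j, 0 < (lam j).re} ⊆
      {lam | ∀ j, lam j ∈ sector (Real.pi / 2 + δ j)} := fun lam hlam j =>
    mem_sector_of_re_pos (hδ j).1 (hδ j).2 (hlam j)
  have hG := differentiableOn_regularize hδ hF m
  rw [hypInt_eq_vertInt hδ ha hG (fun lam => norm_regularize_le_sq hδ hC m) ht]
  exact vertInt_eq_vertInt (hG.mono hs)
    (fun lam hlam => norm_regularize_le_sq hδ hC m (hs hlam)) ha hb t

theorem tendsto_hypInt_regularize (hδ : ∀ j, 0 < δ j ∧ δ j < Real.pi / 2) (ha : ∀ j, 0 < a j)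
    (hF : DifferentiableOn ℂ F {lam | ∀ j, lam j ∈ sector (Real.pi / 2 + δ j)})
    (hC : ∀ lam : Fin n → ℂ, (∀ j, lam j ∈ sector (Real.pi / 2 + δ j)) →
      ‖F lam‖ ≤ C * ∏ j, ‖lam j‖⁻¹) {z : Fin n → ℂ} (hz : ∀ j, z j ∈ sector (δ j)) :
    Tendsto (fun m => hypInt (regularize F m) a δ z) atTop (𝓝 (hypInt F a δ z)) :=
  tendsto_hypInt hδ ha (differentiableOn_regularize hδ hF)
    (fun m _ => norm_regularize_le hδ hC m) (fun lam _ => tendsto_regularize F lam) hz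

theorem hypInt_ofReal_eq (hδ : ∀ j, 0 < δ j ∧ δ j < Real.pi / 2)
    (hδ' : ∀ j, 0 < δ' j ∧ δ' j < Real.pi / 2) (ha : ∀ j, 0 < a j) (ha' : ∀ j, 0 < a' j)
    (hF : DifferentiableOn ℂ F {lam | ∀ j, lam j ∈ sector (Real.pi / 2 + δ j)})
    (hF' : DifferentiableOn ℂ F {lam | ∀ j, lam j ∈ sector (Real.pi / 2 + δ' j)})
    (hC : ∀ lam : Fin n → ℂ, (∀ j, lam j ∈ sector (Real.pi / 2 + δ j)) →
      ‖F lam‖ ≤ C * ∏ j, ‖lam j‖⁻¹)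
    (hC' : ∀ lam : Fin n → ℂ, (∀ j, lam j ∈ sector (Real.pi / 2 + δ' j)) →
      ‖F lam‖ ≤ C' * ∏ j, ‖lam j‖⁻¹) {t : Fin n → ℝ} (ht : ∀ j, 0 < t j) :
    hypInt F a δ (fun j => (t j : ℂ)) = hypInt F a' δ' (fun j => (t j : ℂ)) := by
  refine tendsto_nhds_unique (tendsto_hypInt_regularize hδ ha hF hC fun j =>
    ofReal_mem_sector (hδ j).1 (ht j)) ?_
  refine (tendsto_hypInt_regularize hδ' ha' hF' hC' fun j =>
    ofReal_mem_sector (hδ' j).1 (ht j)).congr fun m => ?_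
  rw [hypInt_regularize_eq_vertInt hδ' ha' hF' hC' ha' ht,
    hypInt_regularize_eq_vertInt hδ ha hF hC ha' ht]

/-- The inverse Laplace integral does not depend on the hyperbola of integration. -/
theorem hypInt_eq_hypInt [CompleteSpace X] (hδ : ∀ j, 0 < δ j ∧ δ j < Real.pi / 2)
    (hδ' : ∀ j, 0 < δ' j ∧ δ' j < Real.pi / 2) (ha : ∀ j, 0 < a j) (ha' : ∀ j, 0 < a' j)
    (hF : DifferentiableOn ℂ F {lam | ∀ j, lam j ∈ sector (Real.pi / 2 + δ j)})
    (hF' : DifferentiableOn ℂ F {lam | ∀ j, lam j ∈ sector (Real.pi / 2 + δ' j)})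
    (hC : ∀ lam : Fin n → ℂ, (∀ j, lam j ∈ sector (Real.pi / 2 + δ j)) →
      ‖F lam‖ ≤ C * ∏ j, ‖lam j‖⁻¹)
    (hC' : ∀ lam : Fin n → ℂ, (∀ j, lam j ∈ sector (Real.pi / 2 + δ' j)) →
      ‖F lam‖ ≤ C' * ∏ j, ‖lam j‖⁻¹) {z : Fin n → ℂ} (hz : ∀ j, z j ∈ sector (δ j))
    (hz' : ∀ j, z j ∈ sector (δ' j)) :
    hypInt F a δ z = hypInt F a' δ' z := by
  refine eq_of_eq_on_positive (δ := fun j => min (δ j) (δ' j))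
    (fun j => lt_min (hδ j).1 (hδ' j).1)
    (fun j => (min_le_left _ _).trans (by linarith [(hδ j).2, Real.pi_pos]))
    ((differentiableOn_hypInt hδ ha hF hC).mono fun z hz j =>
      sector_mono (min_le_left _ _) (hz j))
    ((differentiableOn_hypInt hδ' ha' hF' hC').mono fun z hz j =>
      sector_mono (min_le_right _ _) (hz j))
    (fun t ht => hypInt_ofReal_eq hδ hδ' ha ha' hF hF' hC hC' ht)
    fun j => ⟨(hz j).1, lt_min (hz j).2 (hz' j).2⟩

theorem norm_exp_neg_sum (b t : Fin n → ℝ) :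
    ‖Complex.exp (-(∑ j, (b j : ℂ) * (t j : ℂ)))‖ = ∏ j, Real.exp (-(b j * t j)) := by
  rw [Complex.norm_exp, ← Real.exp_sum]
  simp

theorem continuousOn_exp_smul_hypInt (hδ : ∀ j, 0 < δ j ∧ δ j < Real.pi / 2)
    (ha : ∀ j, 0 < a j)
    (hF : DifferentiableOn ℂ F {lam | ∀ j, lam j ∈ sector (Real.pi / 2 + δ j)})
    (hC : ∀ lam : Fin n → ℂ, (∀ j, lam j ∈ sector (Real.pi / 2 + δ j)) →
      ‖F lam‖ ≤ C * ∏ j, ‖lam j‖⁻¹) (b : Fin n → ℝ) :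
    ContinuousOn (fun t : Fin n → ℝ => Complex.exp (-(∑ j, (b j : ℂ) * (t j : ℂ))) •
      hypInt F a δ fun j => (t j : ℂ)) {t | ∀ j, 0 < t j} := by
  refine ContinuousOn.smul (Continuous.continuousOn (by fun_prop)) ?_
  exact (differentiableOn_hypInt hδ ha hF hC).continuousOn.comp
    (f := fun (t : Fin n → ℝ) j => (t j : ℂ)) (Continuous.continuousOn (by fun_prop))
    fun t ht j => ofReal_mem_sector (hδ j).1 (ht j)

theorem norm_hypInt_ofReal_le (hδ : ∀ j, 0 < δ j ∧ δ j < Real.pi / 2) (ha : ∀ j, 0 < a j)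
    (hF : DifferentiableOn ℂ F {lam | ∀ j, lam j ∈ sector (Real.pi / 2 + δ j)})
    (hC : ∀ lam : Fin n → ℂ, (∀ j, lam j ∈ sector (Real.pi / 2 + δ j)) →
      ‖F lam‖ ≤ C * ∏ j, ‖lam j‖⁻¹) {t : Fin n → ℝ} (ht : ∀ j, 0 < t j) :
    ‖hypInt F a δ fun j => (t j : ℂ)‖ ≤
      (C * ∏ j, (Real.exp 1 * (Real.sin (δ j) * (1 - Real.sin (δ j)))⁻¹)) *
        ∫ s : Fin n → ℝ, ∏ j, (1 + s j ^ 2)⁻¹ := by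
  have hn : ∀ j, (t j : ℂ) ≠ 0 := fun j => Complex.ofReal_ne_zero.2 (ht j).ne'
  rw [hypInt_ofReal_eq hδ hδ ha (a' := fun j => ‖(t j : ℂ)‖⁻¹)
    (fun j => inv_pos.2 (norm_pos_iff.2 (hn j))) hF hF hC hC ht]
  simpa using norm_hypInt_le hδ hC (γ := fun _ => 0) (fun j => ⟨le_rfl, (hδ j).1⟩)
    (z := fun j => (t j : ℂ)) fun j => ⟨hn j, by simp [Complex.arg_ofReal_of_nonneg (ht j).le]⟩

theorem setIntegral_exp_smul_hypInt [CompleteSpace X]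
    (hδ : ∀ j, 0 < δ j ∧ δ j < Real.pi / 2) (ha : ∀ j, 0 < a j)
    (hF : DifferentiableOn ℂ F {lam | ∀ j, lam j ∈ sector (Real.pi / 2 + δ j)})
    (hC : ∀ lam : Fin n → ℂ, (∀ j, lam j ∈ sector (Real.pi / 2 + δ j)) →
      ‖F lam‖ ≤ C * ∏ j, ‖lam j‖⁻¹) {b : Fin n → ℝ} (hb : ∀ j, 0 < b j) :
    ∫ t in {t : Fin n → ℝ | ∀ j, 0 < t j}, Complex.exp (-(∑ j, (b j : ℂ) * (t j : ℂ))) •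
      hypInt F a δ (fun j => (t j : ℂ)) = F fun j => b j := by
  have hS := measurableSet_setOf_forall_pos n
  have hs : {lam : Fin n → ℂ | ∀ j, 0 < (lam j).re} ⊆
      {lam | ∀ j, lam j ∈ sector (Real.pi / 2 + δ j)} := fun lam hlam j =>
    mem_sector_of_re_pos (hδ j).1 (hδ j).2 (hlam j)
  have hG := differentiableOn_regularize hδ hF
  have hint : ∀ m, ∫ t in {t : Fin n → ℝ | ∀ j, 0 < t j},
      Complex.exp (-(∑ j, (b j : ℂ) * (t j : ℂ))) •
        hypInt (regularize F m) a δ (fun j => (t j : ℂ)) = regularize F m fun j => b j := by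
    intro m
    rw [← setIntegral_exp_smul_vertInt ((hG m).mono hs)
      (fun lam hlam => norm_regularize_le_sq hδ hC m (hs hlam)) hb]
    exact setIntegral_congr_fun hS fun t ht => by
      simp only [hypInt_regularize_eq_vertInt hδ ha hF hC hb ht]
  obtain ⟨K, hK⟩ : ∃ K, ∀ (m : ℕ) (t : Fin n → ℝ), (∀ j, 0 < t j) →
      ‖hypInt (regularize F m) a δ fun j => (t j : ℂ)‖ ≤ K :=
    ⟨_, fun m _ ht => norm_hypInt_ofReal_le hδ ha (hG m)
      (fun _ => norm_regularize_le hδ hC m) ht⟩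
  refine tendsto_nhds_unique ?_ ((tendsto_regularize F fun j => (b j : ℂ)).congr fun m =>
    (hint m).symm)
  refine tendsto_integral_of_dominated_convergence _
    (fun m => (continuousOn_exp_smul_hypInt hδ ha (hG m)
      (fun _ => norm_regularize_le hδ hC m) b).aestronglyMeasurable hS)
    ((integrableOn_prod_exp_neg hb).mul_const K) (fun m => ?_) ?_
  · filter_upwards [ae_restrict_mem hS] with t ht
    rw [norm_smul, norm_exp_neg_sum]
    exact mul_le_mul_of_nonneg_left (hK m t ht)
      (Finset.prod_nonneg fun j _ => (Real.exp_pos _).le)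
  · filter_upwards [ae_restrict_mem hS] with t ht
    exact (tendsto_hypInt_regularize hδ ha hF hC fun j =>
      ofReal_mem_sector (hδ j).1 (ht j)).const_smul _

end Independence

/-- A holomorphic function on a product of sectors of angles `π / 2 + α j` that decays like
`∏ j, ‖lam j‖⁻¹` is the Laplace transform of a holomorphic function on the product of the sectors
of angles `α j`. -/
theorem exists_inverse_laplace [CompleteSpace X] {n : ℕ} {α : Fin n → ℝ}
    {F : (Fin n → ℂ) → X} (hα : ∀ j, 0 < α j ∧ α j ≤ Real.pi / 2)
    (hF : DifferentiableOn ℂ F {lam | ∀ j, lam j ∈ sector (Real.pi / 2 + α j)})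
    (hb : ∀ γ : Fin n → ℝ, (∀ j, γ j ∈ Ioo 0 (α j)) → ∃ C, ∀ lam : Fin n → ℂ,
      (∀ j, lam j ∈ sector (Real.pi / 2 + γ j)) → ‖(∏ j, lam j) • F lam‖ ≤ C) :
    ∃ f : (Fin n → ℂ) → X,
      DifferentiableOn ℂ f {z | ∀ j, z j ∈ sector (α j)} ∧
      (∀ γ : Fin n → ℝ, (∀ j, γ j ∈ Ioo 0 (α j)) → ∃ C, ∀ z : Fin n → ℂ,
        (∀ j, z j ∈ sector (γ j)) → ‖f z‖ ≤ C) ∧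
      ∀ b : Fin n → ℝ, (∀ j, 0 < b j) →
        ∫ t in {t : Fin n → ℝ | ∀ j, 0 < t j},
          Complex.exp (-(∑ j, (b j : ℂ) * (t j : ℂ))) • f (fun j => (t j : ℂ)) =
            F fun j => b j := by
  have hδ : ∀ δ : Fin n → ℝ, (∀ j, δ j ∈ Ioo 0 (α j)) → ∀ j, 0 < δ j ∧ δ j < Real.pi / 2 :=
    fun δ h j => ⟨(h j).1, (h j).2.trans_le (hα j).2⟩
  have hFδ : ∀ δ : Fin n → ℝ, (∀ j, δ j ∈ Ioo 0 (α j)) →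
      DifferentiableOn ℂ F {lam | ∀ j, lam j ∈ sector (Real.pi / 2 + δ j)} := fun δ h =>
    hF.mono fun lam hlam j => sector_mono (by linarith [(h j).2]) (hlam j)
  have hC : ∀ δ : Fin n → ℝ, (∀ j, δ j ∈ Ioo 0 (α j)) → ∃ C, ∀ lam : Fin n → ℂ,
      (∀ j, lam j ∈ sector (Real.pi / 2 + δ j)) → ‖F lam‖ ≤ C * ∏ j, ‖lam j‖⁻¹ := by
    intro δ h
    obtain ⟨C, hC⟩ := hb δ h
    refine ⟨C, fun lam hlam => ?_⟩
    have h1 : 0 < ∏ j, ‖lam j‖ := Finset.prod_pos fun j _ => norm_pos_iff.2 (hlam j).1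
    have h2 := hC lam hlam
    rw [norm_smul, norm_prod] at h2
    rw [Finset.prod_inv_distrib, ← div_eq_mul_inv, le_div_iff₀ h1, mul_comm]
    exact h2
  have hmid : ∀ γ : Fin n → ℝ, (∀ j, 0 ≤ γ j ∧ γ j < α j) →
      ∀ j, (γ j + α j) / 2 ∈ Ioo 0 (α j) := fun γ h j =>
    ⟨by linarith [(h j).1, (hα j).1], by linarith [(h j).2]⟩
  have hzδ : ∀ z : Fin n → ℂ, (∀ j, z j ∈ sector (α j)) →
      ∀ j, z j ∈ sector ((|(z j).arg| + α j) / 2) := fun z hz j =>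
    ⟨(hz j).1, by linarith [(hz j).2]⟩
  have key : ∀ z : Fin n → ℂ, (∀ j, z j ∈ sector (α j)) → ∀ a δ : Fin n → ℝ,
      (∀ j, 0 < a j) → (∀ j, δ j ∈ Ioo 0 (α j)) → (∀ j, z j ∈ sector (δ j)) →
      hypInt F (fun _ => 1) (fun j => (|(z j).arg| + α j) / 2) z = hypInt F a δ z := by
    intro z hz a δ ha h hzd
    have h' := hmid (fun j => |(z j).arg|) fun j => ⟨abs_nonneg _, (hz j).2⟩
    obtain ⟨C, hC1⟩ := hC δ h
    obtain ⟨C', hC2⟩ := hC _ h'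
    exact hypInt_eq_hypInt (hδ _ h') (hδ δ h) (fun _ => one_pos) ha (hFδ _ h') (hFδ δ h) hC2 hC1
      (hzδ z hz) hzd
  refine ⟨fun z => hypInt F (fun _ => 1) (fun j => (|(z j).arg| + α j) / 2) z, ?_, ?_, ?_⟩
  · intro z hz
    have h' := hmid (fun j => |(z j).arg|) fun j => ⟨abs_nonneg _, (hz j).2⟩
    obtain ⟨C, hC'⟩ := hC _ h'
    have hO := (isOpen_setOf_forall_mem_sector (fun j => (h' j).1) fun j => by
      linarith [(hδ _ h' j).2, Real.pi_pos]).mem_nhds (hzδ z hz)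
    refine (((differentiableOn_hypInt (hδ _ h') (a := fun _ => 1) (fun _ => one_pos) (hFδ _ h')
      hC').differentiableAt hO).congr_of_eventuallyEq ?_).differentiableWithinAt
    filter_upwards [hO] with w hw
    exact key w (fun j => sector_mono (h' j).2.le (hw j)) _ _ (fun _ => one_pos) h' hw
  · intro γ hγ
    have h' := hmid γ fun j => ⟨(hγ j).1.le, (hγ j).2⟩
    obtain ⟨C, hC'⟩ := hC _ h'
    refine ⟨_, fun z hz => (congrArg norm (key z (fun j => sector_mono (hγ j).2.le (hz j))
      (fun j => ‖z j‖⁻¹) _ (fun j => inv_pos.2 (norm_pos_iff.2 (hz j).1)) h'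
      fun j => sector_mono (by linarith [(hγ j).2]) (hz j))).trans_le
      (norm_hypInt_le (hδ _ h') hC' (fun j => ⟨(hγ j).1.le, by linarith [(hγ j).2]⟩)
        fun j => ⟨(hz j).1, (hz j).2.le⟩)⟩
  · intro b hb'
    have h' := hmid (fun _ => 0) fun j => ⟨le_rfl, (hα j).1⟩
    obtain ⟨C, hC'⟩ := hC _ h'
    rw [← setIntegral_exp_smul_hypInt (hδ _ h') (a := fun _ => 1) (fun _ => one_pos) (hFδ _ h')
      hC' hb']
    refine setIntegral_congr_fun (measurableSet_setOf_forall_pos n) fun t ht => ?_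
    simp only
    rw [key _ (fun j => ofReal_mem_sector (hα j).1 (ht j)) _ _ (fun _ => one_pos) h'
      fun j => ofReal_mem_sector (h' j).1 (ht j)]

/-- Analytic representation theorem: `F` on `(ω₁,∞)×…×(ωₙ,∞)` is the Laplace transform of a
holomorphic function on `Σ_{α₁}×…×Σ_{αₙ}`, bounded (after scaling by `e^{−ω·z}`) on all
smaller products of sectors, iff `F` extends holomorphically to
`(ω₁+Σ_{π/2+α₁})×…×(ωₙ+Σ_{π/2+αₙ})` with `(λ₁−ω₁)·…·(λₙ−ωₙ)·F̃(λ)` bounded on all smaller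
products of shifted sectors. -/
theorem analytic_representation [CompleteSpace X]
    (n : ℕ) (hn : 1 ≤ n) (ω α : Fin n → ℝ)
    (hα : ∀ j, 0 < α j ∧ α j ≤ Real.pi / 2)
    (F : (Fin n → ℝ) → X) :
    (∃ f : (Fin n → ℂ) → X,
      DifferentiableOn ℂ f {z : Fin n → ℂ | ∀ j, z j ∈ sector (α j)} ∧
      (∀ lam : Fin n → ℝ, (∀ j, ω j < lam j) →
        IntegrableOn
          (fun t : Fin n → ℝ =>
            Complex.exp (-(∑ j, (lam j : ℂ) * (t j : ℂ))) • f (fun j => (t j : ℂ)))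
          {t : Fin n → ℝ | ∀ j, 0 < t j} ∧
        (∫ t in {t : Fin n → ℝ | ∀ j, 0 < t j},
            Complex.exp (-(∑ j, (lam j : ℂ) * (t j : ℂ))) • f (fun j => (t j : ℂ))) =
          F lam) ∧
      (∀ γ : Fin n → ℝ, (∀ j, γ j ∈ Set.Ioo 0 (α j)) →
        ∃ C, ∀ z : Fin n → ℂ, (∀ j, z j ∈ sector (γ j)) →
          ‖Complex.exp (-(∑ j, (ω j : ℂ) * z j)) • f z‖ ≤ C)) ↔
    (∃ Ftil : (Fin n → ℂ) → X,
      DifferentiableOn ℂ Ftil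
        {lam : Fin n → ℂ | ∀ j, lam j - (ω j : ℂ) ∈ sector (Real.pi / 2 + α j)} ∧
      (∀ lam : Fin n → ℝ, (∀ j, ω j < lam j) → Ftil (fun j => (lam j : ℂ)) = F lam) ∧
      (∀ γ : Fin n → ℝ, (∀ j, γ j ∈ Set.Ioo 0 (α j)) →
        ∃ C, ∀ lam : Fin n → ℂ,
          (∀ j, lam j - (ω j : ℂ) ∈ sector (Real.pi / 2 + γ j)) →
          ‖(∏ j, (lam j - (ω j : ℂ))) • Ftil lam‖ ≤ C)) := by
  constructor
  · rintro ⟨f, hf, hint, hbd⟩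
    obtain ⟨G, hG, hGL, hGb⟩ := exists_laplace_extension hα
      (g := fun z => Complex.exp (-(∑ j, (ω j : ℂ) * z j)) • f z)
      (DifferentiableOn.smul (Differentiable.differentiableOn (by fun_prop)) hf) hbd
    refine ⟨fun lam => G fun j => lam j - ω j,
      hG.comp (f := fun (lam : Fin n → ℂ) j => lam j - ω j)
        (Differentiable.differentiableOn (by fun_prop)) fun lam hlam => hlam,
      fun lam hlam => ?_, fun γ hγ => ?_⟩
    · have := hGL (fun j => lam j - ω j) fun j => sub_pos.2 (hlam j)
      push_cast at this
      simp only
      rw [this, ← (hint lam hlam).2]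
      congr 1
      funext t
      rw [smul_smul, ← Complex.exp_add, ← neg_add, ← Finset.sum_add_distrib]
      simp only [← add_mul, sub_add_cancel]
    · obtain ⟨C, hC⟩ := hGb γ hγ
      exact ⟨C, fun lam hlam => hC _ hlam⟩
  · rintro ⟨G, hG, hGF, hGb⟩
    obtain ⟨f, hf, hfb, hfL⟩ := exists_inverse_laplace hα
      (F := fun mu => G fun j => mu j + ω j)
      (hG.comp (f := fun (mu : Fin n → ℂ) j => mu j + ω j)
        (Differentiable.differentiableOn (by fun_prop)) fun mu hmu j => by simpa using hmu j)
      fun γ hγ => by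
        obtain ⟨C, hC⟩ := hGb γ hγ
        exact ⟨C, fun mu hmu => by simpa using hC (fun j => mu j + ω j) (by simpa using hmu)⟩
    have hker : ∀ (lam t : Fin n → ℝ), Complex.exp (-(∑ j, (lam j : ℂ) * (t j : ℂ))) •
        Complex.exp (∑ j, (ω j : ℂ) * (t j : ℂ)) • f (fun j => (t j : ℂ)) =
        Complex.exp (-(∑ j, ((lam j - ω j : ℝ) : ℂ) * (t j : ℂ))) •
          f fun j => (t j : ℂ) := by
      intro lam t
      rw [smul_smul, ← Complex.exp_add]
      congr 2
      push_cast
      simp only [sub_mul, Finset.sum_sub_distrib]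
      ring
    refine ⟨fun z => Complex.exp (∑ j, (ω j : ℂ) * z j) • f z,
      DifferentiableOn.smul (Differentiable.differentiableOn (by fun_prop)) hf,
      fun lam hlam => ⟨?_, ?_⟩, fun γ hγ => ?_⟩
    · simp only [hker]
      have hS := measurableSet_setOf_forall_pos n
      obtain ⟨C, hC⟩ := hfb (fun j => α j / 2) fun j =>
        ⟨half_pos (hα j).1, half_lt_self (hα j).1⟩
      refine ((integrableOn_prod_exp_neg (c := fun j => lam j - ω j) fun j =>
        sub_pos.2 (hlam j)).mul_const C).mono' (ContinuousOn.aestronglyMeasurable ?_ hS) ?_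
      · refine ContinuousOn.smul (Continuous.continuousOn (by fun_prop)) ?_
        exact hf.continuousOn.comp (f := fun (t : Fin n → ℝ) j => (t j : ℂ))
          (Continuous.continuousOn (by fun_prop)) fun t ht j =>
            ofReal_mem_sector (hα j).1 (ht j)
      · filter_upwards [ae_restrict_mem hS] with t ht
        rw [norm_smul, norm_exp_neg_sum (fun j => lam j - ω j)]
        exact mul_le_mul_of_nonneg_left
          (hC _ fun j => ofReal_mem_sector (half_pos (hα j).1) (ht j))
          (Finset.prod_nonneg fun j _ => (Real.exp_pos _).le)
    · simp only [hker]
      rw [hfL (fun j => lam j - ω j) fun j => sub_pos.2 (hlam j), ← hGF lam hlam]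
      simp
    · obtain ⟨C, hC⟩ := hfb γ hγ
      refine ⟨C, fun z hz => ?_⟩
      rw [smul_smul, ← Complex.exp_add, neg_add_cancel, Complex.exp_zero, one_smul]
      exact hC z hz
end
end

section
/- Let X be a complex Banach space, n ≥ 1, and let f : [0,∞)^n → X be locally Bochner integrable. Suppose λ⁰ = (λ₁⁰,…,λₙ⁰) ∈ Ω_b(f) and there exist real numbers a₁ > Re λ₁⁰, …, aₙ > Re λₙ⁰ such that for all real λ₁ > a₁, …, λₙ > aₙ the Laplace integral of f converges at (λ₁,…,λₙ) with value 0. Then f(t₁,…,tₙ) = 0 for almost every (t₁,…,tₙ) ∈ [0,∞)^n. -/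
open MeasureTheory Set Filter

noncomputable section

variable {X : Type*} [NormedAddCommGroup X] [NormedSpace ℂ X]

open scoped Topology

lemma orthant_eq_Ici (n : ℕ) : orthant n = Ici 0 := rfl

lemma box_eq_Icc {n : ℕ} (t : Fin n → ℝ) : box t = Icc 0 t :=
  Set.pi_univ_Icc 0 t

lemma Icc_zero_inter_Iic {n : ℕ} (t x : Fin n → ℝ) : Icc 0 t ∩ Iic x = Icc 0 (t ⊓ x) := by
  ext
  simp [and_assoc]

/-- A function on the orthant whose integrals over all boxes vanish is zero almost everywhere. -/
lemma ae_eq_zero_of_forall_integral_Icc_eq_zero {n : ℕ} {g : (Fin n → ℝ) → X} [CompleteSpace X]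
    (hg : ∀ t, IntegrableOn g (Icc 0 t)) (h : ∀ t, ∫ s in Icc 0 t, g s = 0) :
    ∀ᵐ t ∂(volume.restrict (Ici 0)), g t = 0 := by
  have hU : (Ici 0 : Set (Fin n → ℝ)) = ⋃ N : ℕ, Icc 0 (fun _ => (N : ℝ)) := by
    ext x
    simp only [mem_Ici, mem_iUnion, mem_Icc, exists_and_left, iff_self_and]
    intro _
    obtain ⟨N, hN⟩ := exists_nat_ge (∑ j, |x j|)
    exact ⟨N, fun j => (le_abs_self _).trans
      ((Finset.single_le_sum (f := fun j => |x j|) (fun i _ => abs_nonneg _)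
        (Finset.mem_univ j)).trans hN)⟩
  rw [hU, ae_restrict_iUnion_iff]
  intro N
  refine Integrable.ae_eq_zero_of_forall_setIntegral_eq_zero (hg _) fun s hs _ => ?_
  have hspan : ∀ _ : Fin n, IsCountablySpanning (range (Iic : ℝ → Set ℝ)) := fun _ =>
    ⟨fun k : ℕ => Iic (k : ℝ), fun k => ⟨_, rfl⟩, by
      ext x
      simpa using exists_nat_ge x⟩
  have hgen := generateFrom_eq_pi (h := fun _ : Fin n => Real.measurableSpace)
    (fun _ => ((borel_eq_generateFrom_Iic ℝ).symm.trans
      (BorelSpace.measurable_eq (α := ℝ)).symm)) hspan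
  induction s, hs using MeasurableSpace.induction_on_inter hgen.symm
    (IsPiSystem.pi fun _ => isPiSystem_Iic) with
  | empty => simp
  | basic t ht =>
    obtain ⟨S, hS, rfl⟩ := ht
    choose x hx using fun j => hS j (mem_univ j)
    have : univ.pi S = Iic x := by
      rw [← Set.pi_univ_Iic]
      exact congrArg _ (funext fun j => (hx j).symm)
    rw [this, Measure.restrict_restrict measurableSet_Iic, inter_comm, Icc_zero_inter_Iic]
    exact h _
  | compl t ht ih =>
    have := integral_add_compl ht (hg fun _ => (N : ℝ))
    rw [ih (measure_lt_top_of_subset (subset_univ _) (by simp [measure_Icc_lt_top.ne])), h] at this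
    simpa using this
  | iUnion f hd hm ih =>
    rw [integral_iUnion hm hd (hg _).integrableOn]
    simp only [ih _ (measure_lt_top_of_subset (subset_univ _) (by simp [measure_Icc_lt_top.ne])),
      tsum_zero]

lemma prod_exp_neg {n : ℕ} (mu : Fin n → ℂ) (r : Fin n → ℝ) :
    Complex.exp (-(∑ j, mu j * (r j : ℂ))) = ∏ j, Complex.exp (-mu j * (r j : ℂ)) := by
  rw [← Complex.exp_sum, ← Finset.sum_neg_distrib]
  simp only [neg_mul]

lemma volume_restrict_Ici {n : ℕ} (s : Fin n → ℝ) :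
    (volume.restrict (Ici s)) = Measure.pi fun j => volume.restrict (Ici (s j)) := by
  rw [← Set.pi_univ_Ici, volume_pi, Measure.restrict_pi_pi]

lemma integrableOn_exp_Ici {n : ℕ} {mu : Fin n → ℂ} (hmu : ∀ j, 0 < (mu j).re)
    (s : Fin n → ℝ) :
    IntegrableOn (fun r : Fin n → ℝ => Complex.exp (-(∑ j, mu j * (r j : ℂ)))) (Ici s) := by
  simp_rw [IntegrableOn, volume_restrict_Ici, prod_exp_neg]
  refine Integrable.fintype_prod (f := fun j (x : ℝ) => Complex.exp (-mu j * x)) fun j => ?_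
  rw [Measure.restrict_congr_set Ioi_ae_eq_Ici.symm]
  exact integrableOn_exp_mul_complex_Ioi (by simpa using hmu j) _

lemma integral_exp_Ici {n : ℕ} {mu : Fin n → ℂ} (hmu : ∀ j, 0 < (mu j).re)
    (s : Fin n → ℝ) :
    (∏ j, mu j) * ∫ r in Ici s, Complex.exp (-(∑ j, mu j * (r j : ℂ))) =
      Complex.exp (-(∑ j, mu j * (s j : ℂ))) := by
  simp_rw [volume_restrict_Ici, prod_exp_neg]
  rw [integral_fintype_prod_eq_prod (f := fun j (x : ℝ) => Complex.exp (-mu j * x)),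
    ← Finset.prod_mul_distrib]
  refine Finset.prod_congr rfl fun j _ => ?_
  rw [integral_Ici_eq_integral_Ioi, integral_exp_mul_complex_Ioi (by simpa using hmu j)]
  have : mu j ≠ 0 := fun h => by simpa [h] using hmu j
  field_simp

/-- The truncated Laplace integral of `g`, written as a weighted average of box integrals
of `g`. -/
lemma integral_exp_smul_Icc {n : ℕ} {mu : Fin n → ℂ} (hmu : ∀ j, 0 < (mu j).re)
    {g : (Fin n → ℝ) → X} {t : Fin n → ℝ} (hg : IntegrableOn g (Icc 0 t)) [CompleteSpace X] :
    IntegrableOn (lapKer mu fun r => ∫ s in Icc 0 (r ⊓ t), g s) (Ici 0) ∧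
    ∫ s in Icc 0 t, lapKer mu g s =
      (∏ j, mu j) • ∫ r in Ici 0, lapKer mu (fun r => ∫ s in Icc 0 (r ⊓ t), g s) r := by
  set E : (Fin n → ℝ) → ℂ := fun r => Complex.exp (-(∑ j, mu j * (r j : ℂ))) with hE
  have hint : Integrable (fun p : (Fin n → ℝ) × (Fin n → ℝ) =>
      {p : (Fin n → ℝ) × (Fin n → ℝ) | p.2 ≤ p.1}.indicator (fun p => E p.1 • g p.2) p)
      ((volume.restrict (Ici 0)).prod (volume.restrict (Icc 0 t))) :=
    ((integrableOn_exp_Ici hmu 0).smul_prod hg).indicator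
      (isClosed_le continuous_snd continuous_fst).measurableSet
  have h1 : ∀ r, lapKer mu (fun r => ∫ s in Icc 0 (r ⊓ t), g s) r =
      ∫ s in Icc 0 t, {p : (Fin n → ℝ) × (Fin n → ℝ) | p.2 ≤ p.1}.indicator
        (fun p => E p.1 • g p.2) (r, s) := by
    intro r
    have : ∀ s, {p : (Fin n → ℝ) × (Fin n → ℝ) | p.2 ≤ p.1}.indicator
        (fun p => E p.1 • g p.2) (r, s) = E r • (Iic r).indicator g s := by
      intro s
      by_cases h : s ≤ r <;> simp [indicator, h]
    simp_rw [this]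
    rw [integral_smul, setIntegral_indicator measurableSet_Iic, Icc_zero_inter_Iic, inf_comm]
    rfl
  refine ⟨(funext h1 ▸ hint.integral_prod_left :), ?_⟩
  simp_rw [h1]
  rw [integral_integral_swap hint, ← integral_smul]
  refine setIntegral_congr_fun measurableSet_Icc fun s hs => ?_
  have : ∀ r, {p : (Fin n → ℝ) × (Fin n → ℝ) | p.2 ≤ p.1}.indicator
      (fun p => E p.1 • g p.2) (r, s) = (Ici s).indicator E r • g s := by
    intro r
    by_cases h : s ≤ r <;> simp [indicator, h]
  simp_rw [this]
  rw [integral_smul_const, setIntegral_indicator measurableSet_Ici, smul_smul,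
    inter_eq_self_of_subset_right (Ici_subset_Ici.2 hs.1), integral_exp_Ici hmu]
  rfl

/-- The change of variables `r ↦ (e^{-r₁}, …, e^{-rₙ})`, clamped to the unit cube. -/
def expNegCube {n : ℕ} (r : Fin n → ℝ) : Fin n → unitInterval :=
  fun j => projIcc 0 1 zero_le_one (Real.exp (-r j))

lemma continuous_expNegCube {n : ℕ} : Continuous (expNegCube (n := n)) :=
  continuous_pi fun j => continuous_projIcc.comp (by fun_prop)

lemma expNegCube_coe {n : ℕ} {r : Fin n → ℝ} (hr : 0 ≤ r) (j : Fin n) :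
    (expNegCube r j : ℝ) = Real.exp (-r j) := by
  have : Real.exp (-r j) ∈ Icc (0 : ℝ) 1 :=
    ⟨(Real.exp_pos _).le, Real.exp_le_one_iff.2 (neg_nonpos.2 (hr j))⟩
  rw [expNegCube, projIcc_of_mem zero_le_one this]

lemma integrable_continuousMap_smul {n : ℕ} {ν : Measure (Fin n → ℝ)} {h : (Fin n → ℝ) → X}
    (hh : Integrable h ν) (φ : C(Fin n → unitInterval, ℝ)) :
    Integrable (fun r => φ (expNegCube r) • h r) ν :=
  (hh.norm.const_mul ‖φ‖).mono'
    ((φ.continuous.comp continuous_expNegCube).aestronglyMeasurable.smul hh.aestronglyMeasurable)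
    (Eventually.of_forall fun r => by
      rw [norm_smul]
      gcongr
      exact φ.norm_coe_le_norm _)

/-- If all moments of `h` against monomials in `e^{-rⱼ}` vanish, so do the integrals of `h`
against continuous functions of the `e^{-rⱼ}`. -/
lemma integral_continuousMap_smul_eq_zero {n : ℕ} {h : (Fin n → ℝ) → X}
    (hh : IntegrableOn h (Ici 0))
    (hm : ∀ p : Fin n → ℕ, ∫ r in Ici 0, (∏ j, Real.exp (-r j) ^ p j) • h r = 0)
    (φ : C(Fin n → unitInterval, ℝ)) :
    ∫ r in Ici 0, φ (expNegCube r) • h r = 0 := by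
  let L : C(Fin n → unitInterval, ℝ) →ₗ[ℝ] X :=
    { toFun := fun φ => ∫ r in Ici 0, φ (expNegCube r) • h r
      map_add' := fun φ ψ => by
        simp only [ContinuousMap.add_apply, add_smul]
        exact integral_add (integrable_continuousMap_smul hh φ)
          (integrable_continuousMap_smul hh ψ)
      map_smul' := fun c φ => by
        simp only [ContinuousMap.smul_apply, smul_assoc, RingHom.id_apply]
        exact integral_smul _ _ }
  have hL : Continuous L := by
    refine AddMonoidHomClass.continuous_of_bound L (∫ r in Ici 0, ‖h r‖) fun φ => ?_
    rw [mul_comm, ← integral_const_mul]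
    refine norm_integral_le_of_norm_le (hh.norm.const_mul _) (Eventually.of_forall fun r => ?_)
    rw [norm_smul]
    gcongr
    exact φ.norm_coe_le_norm _
  let x : Fin n → C(Fin n → unitInterval, ℝ) := fun j => ⟨fun y => (y j : ℝ), by fun_prop⟩
  set A := Algebra.adjoin ℝ (range x) with hA_def
  have hA : ∀ ψ ∈ A, L ψ = 0 := by
    intro ψ hψ
    rw [hA_def, Algebra.adjoin_range_eq_range_aeval] at hψ
    obtain ⟨P, rfl⟩ := hψ
    change L (MvPolynomial.aeval x P) = 0
    rw [MvPolynomial.aeval_def, MvPolynomial.eval₂_eq', map_sum]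
    refine Finset.sum_eq_zero fun d _ => ?_
    rw [← Algebra.smul_def, map_smul]
    convert smul_zero _
    rw [← hm d]
    refine setIntegral_congr_fun measurableSet_Ici fun r hr => ?_
    simp only [ContinuousMap.prod_apply, ContinuousMap.pow_apply]
    congr 1
    exact Finset.prod_congr rfl fun j _ => congrArg (· ^ d j) (expNegCube_coe hr j)
  have hsep : A.SeparatesPoints := by
    intro y z hyz
    obtain ⟨j, hj⟩ := Function.ne_iff.1 hyz
    exact ⟨x j, ⟨x j, Algebra.subset_adjoin ⟨j, rfl⟩, rfl⟩, fun e => hj (Subtype.ext e)⟩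
  have hmem : φ ∈ closure (A : Set C(Fin n → unitInterval, ℝ)) := by
    rw [← Subalgebra.topologicalClosure_coe,
      ContinuousMap.subalgebra_topologicalClosure_eq_top_of_separatesPoints A hsep]
    trivial
  exact closure_minimal (t := L ⁻¹' {0}) hA (isClosed_singleton.preimage hL) hmem

/-- An integrable function on the orthant all of whose moments against monomials in `e^{-rⱼ}`
vanish is zero almost everywhere. -/
lemma ae_eq_zero_of_moments_eq_zero {n : ℕ} {h : (Fin n → ℝ) → X} [CompleteSpace X]
    (hh : IntegrableOn h (Ici 0))
    (hm : ∀ p : Fin n → ℕ, ∫ r in Ici 0, (∏ j, Real.exp (-r j) ^ p j) • h r = 0) :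
    ∀ᵐ r ∂(volume.restrict (Ici 0)), h r = 0 := by
  refine ae_eq_zero_of_forall_integral_Icc_eq_zero
    (fun t => hh.mono_set Icc_subset_Ici_self) fun t => ?_
  let F : Set (Fin n → unitInterval) := {y | ∀ j, Real.exp (-t j) ≤ y j}
  have hF : IsClosed F := by
    simp only [F, ofPred_forall]
    exact isClosed_iInter fun j => isClosed_le continuous_const (by fun_prop)
  have key : ∀ r ∈ Ici (0 : Fin n → ℝ), expNegCube r ∈ F ↔ r ∈ Iic t := by
    intro r hr
    simp only [F, mem_ofPred_eq, expNegCube_coe hr, Real.exp_le_exp, neg_le_neg_iff]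
    rfl
  have hlim : Tendsto (fun k => ∫ r in Ici 0, (hF.apprSeq k (expNegCube r) : ℝ) • h r) atTop
      (𝓝 (∫ r in Ici 0, (Iic t).indicator h r)) := by
    refine tendsto_integral_of_dominated_convergence (fun r => ‖h r‖) (fun k => ?_) hh.norm
      (fun k => Eventually.of_forall fun r => ?_) ?_
    · exact (NNReal.continuous_coe.comp ((hF.apprSeq k).continuous.comp
        continuous_expNegCube)).aestronglyMeasurable.smul hh.aestronglyMeasurable
    · rw [norm_smul, Real.norm_of_nonneg (NNReal.coe_nonneg _)]
      exact mul_le_of_le_one_left (norm_nonneg _)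
        (by exact_mod_cast HasOuterApproxClosed.apprSeq_apply_le_one hF k _)
    · filter_upwards [ae_restrict_mem measurableSet_Ici] with r hr
      have h1 := tendsto_pi_nhds.1 (HasOuterApproxClosed.tendsto_apprSeq hF) (expNegCube r)
      have h2 := ((NNReal.continuous_coe.tendsto _).comp h1).smul_const (h r)
      suffices he : ((F.indicator (fun _ => (1 : NNReal)) (expNegCube r) : NNReal) : ℝ) • h r =
          (Iic t).indicator h r from he ▸ h2
      by_cases hrt : r ∈ Iic t
      · rw [indicator_of_mem hrt, indicator_of_mem ((key r hr).2 hrt)]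
        simp
      · rw [indicator_of_notMem hrt, indicator_of_notMem (mt (key r hr).1 hrt)]
        simp
  have hz : ∀ k, ∫ r in Ici 0, (hF.apprSeq k (expNegCube r) : ℝ) • h r = 0 := fun k =>
    integral_continuousMap_smul_eq_zero hh hm
      ⟨fun y => (hF.apprSeq k y : ℝ), NNReal.continuous_coe.comp (hF.apprSeq k).continuous⟩
  simp only [hz] at hlim
  have := tendsto_nhds_unique hlim tendsto_const_nhds
  rwa [setIntegral_indicator measurableSet_Iic, Ici_inter_Iic] at this

/-- If the box integrals of `g` vanish for almost every box, they all vanish. -/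
lemma integral_Icc_eq_zero_of_ae {n : ℕ} {g : (Fin n → ℝ) → X}
    (hg : ∀ t, IntegrableOn g (Icc 0 t))
    (h : ∀ᵐ t ∂(volume.restrict (Ici 0)), ∫ s in Icc 0 t, g s = 0) (t : Fin n → ℝ) :
    ∫ s in Icc 0 t, g s = 0 := by
  by_cases ht : 0 ≤ t
  swap
  · simp [Icc_eq_empty ht]
  have hex : ∀ k : ℕ, ∃ u : Fin n → ℝ, (∀ j, u j ∈ Ioo (t j) (t j + 1 / ((k : ℝ) + 1))) ∧
      ∫ s in Icc 0 u, g s = 0 := by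
    intro k
    have hpos : volume (univ.pi fun j => Ioo (t j) (t j + 1 / ((k : ℝ) + 1))) ≠ 0 := by
      rw [Real.volume_pi_Ioo]
      refine Finset.prod_ne_zero_iff.2 fun j _ => ?_
      simp only [add_sub_cancel_left, ne_eq, ENNReal.ofReal_eq_zero, not_le]
      positivity
    rw [ae_restrict_iff' measurableSet_Ici] at h
    obtain ⟨u, hu, hu'⟩ := ((frequently_ae_mem_iff.2 hpos).and_eventually h).exists
    have hu0 := fun j => hu j (mem_univ j)
    exact ⟨u, hu0, hu' fun j => (ht j).trans (hu0 j).1.le⟩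
  choose u hu hu0 using hex
  have hut : ∀ k, t ≤ u k := fun k j => (hu k j).1.le
  have hlim : ∀ j, Tendsto (fun k => u k j) atTop (𝓝 (t j)) := fun j =>
    tendsto_of_tendsto_of_tendsto_of_le_of_le tendsto_const_nhds
      (by simpa using tendsto_one_div_add_atTop_nhds_zero_nat.const_add (t j))
      (fun k => (hu k j).1.le) (fun k => (hu k j).2.le)
  have hle : ∀ k, u k ≤ t + 1 := fun k j => (hu k j).2.le.trans <| by
    have : 1 / ((k : ℝ) + 1) ≤ 1 := by
      rw [div_le_one (by positivity)]
      linarith [k.cast_nonneg (α := ℝ)]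
    simpa using this
  have hconv : Tendsto (fun k => ∫ s in Icc 0 (t + 1), (Icc 0 (u k)).indicator g s) atTop
      (𝓝 (∫ s in Icc 0 (t + 1), (Icc 0 t).indicator g s)) := by
    refine tendsto_integral_of_dominated_convergence (fun s => ‖g s‖)
      (fun k => (hg _).aestronglyMeasurable.indicator measurableSet_Icc) (hg _).norm
      (fun k => Eventually.of_forall fun s => norm_indicator_le_norm_self _ _)
      (Eventually.of_forall fun s => ?_)
    refine tendsto_const_nhds.congr' ?_
    by_cases hs : s ∈ Icc 0 t
    · refine Eventually.of_forall fun k => ?_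
      dsimp only
      rw [indicator_of_mem hs, indicator_of_mem (Icc_subset_Icc_right (hut k) hs)]
    · by_cases hs0 : 0 ≤ s
      · have : ∃ j, t j < s j := by
          by_contra! hc
          exact hs ⟨hs0, hc⟩
        obtain ⟨j, hj⟩ := this
        filter_upwards [(hlim j).eventually_lt_const hj] with k hk
        rw [indicator_of_notMem hs, indicator_of_notMem fun hc => (hc.2 j).not_gt hk]
      · refine Eventually.of_forall fun k => ?_
        dsimp only
        rw [indicator_of_notMem hs, indicator_of_notMem fun hc : s ∈ Icc 0 (u k) => hs0 hc.1]
  have hres : ∀ v ≤ t + 1, ∫ s in Icc 0 (t + 1), (Icc 0 v).indicator g s = ∫ s in Icc 0 v, g s := by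
    intro v hv
    rw [setIntegral_indicator measurableSet_Icc,
      inter_eq_self_of_subset_right (Icc_subset_Icc_right hv)]
  rw [hres t ((hut 0).trans (hle 0))] at hconv
  simp only [hres _ (hle _), hu0] at hconv
  exact tendsto_nhds_unique hconv tendsto_const_nhds

lemma continuous_exp_neg_sum {n : ℕ} (mu : Fin n → ℂ) :
    Continuous fun r : Fin n → ℝ => Complex.exp (-(∑ j, mu j * (r j : ℂ))) := by
  fun_prop

lemma integrableOn_lapKer_Icc {n : ℕ} {f : (Fin n → ℝ) → X} (hf : LocInt f) (mu : Fin n → ℂ)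
    (t : Fin n → ℝ) : IntegrableOn (lapKer mu f) (Icc 0 t) := by
  have := hf t
  rw [box_eq_Icc] at this
  exact this.continuousOn_smul (continuous_exp_neg_sum mu).continuousOn isCompact_Icc

lemma lapKer_lapKer {n : ℕ} (mu nu : Fin n → ℂ) (f : (Fin n → ℝ) → X) :
    lapKer mu (lapKer nu f) = lapKer (mu + nu) f := by
  funext r
  simp only [lapKer, smul_smul, ← Complex.exp_add, Pi.add_apply, add_mul, Finset.sum_add_distrib,
    neg_add]

/-- If the box integrals of `g` are bounded and the Laplace integral of `g` converges to `0` at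
`mu`, then the Laplace integral of the box integrals of `g` is absolutely convergent to `0`. -/
lemma integral_lapKer_integral_Icc_eq_zero {n : ℕ} {g : (Fin n → ℝ) → X} [CompleteSpace X]
    (hg : ∀ t, IntegrableOn g (Icc 0 t)) {C : ℝ} (hC : ∀ t, ‖∫ s in Icc 0 t, g s‖ ≤ C)
    {mu : Fin n → ℂ} (hmu : ∀ j, 0 < (mu j).re) (h0 : LapConvTo g mu 0) :
    IntegrableOn (lapKer mu fun r => ∫ s in Icc 0 r, g s) (Ici 0) ∧
      ∫ r in Ici 0, lapKer mu (fun r => ∫ s in Icc 0 r, g s) r = 0 := by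
  set T : ℕ → Fin n → ℝ := fun k _ => k
  have hpt : ∀ r, Tendsto (fun k => lapKer mu (fun r => ∫ s in Icc 0 (r ⊓ T k), g s) r) atTop
      (𝓝 (lapKer mu (fun r => ∫ s in Icc 0 r, g s) r)) := by
    intro r
    refine tendsto_const_nhds.congr' ?_
    have : ∀ᶠ k : ℕ in atTop, ∀ j, r j ≤ k :=
      eventually_all.2 fun j => tendsto_natCast_atTop_atTop.eventually_ge_atTop (r j)
    filter_upwards [this] with k hk
    have : r ⊓ T k = r := inf_eq_left.2 hk
    simp only [lapKer, this]
  have hbd := (integrableOn_exp_Ici hmu 0).norm.mul_const C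
  have hmeas := fun k => (integral_exp_smul_Icc hmu (hg (T k))).1.aestronglyMeasurable
  refine ⟨hbd.mono' (aestronglyMeasurable_of_tendsto_ae atTop hmeas (Eventually.of_forall hpt))
    (Eventually.of_forall fun r => ?_), ?_⟩
  · rw [lapKer, norm_smul]
    gcongr
    exact hC _
  have hlim := tendsto_integral_of_dominated_convergence _ hmeas hbd
    (fun k => Eventually.of_forall fun r => by
      rw [lapKer, norm_smul]
      gcongr
      exact hC _) (Eventually.of_forall hpt)
  have hprod : ∏ j, mu j ≠ 0 :=
    Finset.prod_ne_zero_iff.2 fun j _ h => by simpa [h] using hmu j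
  have hlim0 : Tendsto (fun k => truncInt g mu (T k)) atTop (𝓝 0) := by
    rw [Metric.tendsto_atTop]
    intro ε hε
    obtain ⟨M, -, hM⟩ := h0 ε hε
    obtain ⟨N, hN⟩ := exists_nat_gt M
    exact ⟨N, fun k hk => by
      rw [dist_eq_norm]
      exact hM _ fun _ => hN.trans_le (Nat.cast_le.2 hk)⟩
  have heq : ∀ k, truncInt g mu (T k) = (∏ j, mu j) •
      ∫ r in Ici 0, lapKer mu (fun r => ∫ s in Icc 0 (r ⊓ T k), g s) r := fun k => by
    rw [truncInt, box_eq_Icc]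
    exact (integral_exp_smul_Icc hmu (hg (T k))).2
  simp only [heq] at hlim0
  exact (smul_eq_zero.1 (tendsto_nhds_unique (hlim.const_smul _) hlim0)).resolve_left hprod

/-- Uniqueness theorem: if `λ⁰ ∈ Ω_b(f)` and the Laplace integral of `f` converges with value
`0` at all real `λ` with `λⱼ > aⱼ` for some `aⱼ > Re λⱼ⁰`, then `f = 0` almost everywhere on
`[0,∞)^n`. -/
theorem laplace_uniqueness [CompleteSpace X]
    (n : ℕ) (hn : 1 ≤ n) (f : (Fin n → ℝ) → X) (hf : LocInt f)
    (lam0 : Fin n → ℂ) (h0 : OmegaBdd f lam0)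
    (a : Fin n → ℝ) (ha : ∀ j, (lam0 j).re < a j)
    (hzero : ∀ lam : Fin n → ℝ, (∀ j, a j < lam j) →
      LapConvTo f (fun j => (lam j : ℂ)) 0) :
    ∀ᵐ t ∂(volume.restrict (orthant n)), f t = 0 := by
  set g := lapKer lam0 f with hg_def
  have hg : ∀ t, IntegrableOn g (Icc 0 t) := integrableOn_lapKer_Icc hf lam0
  obtain ⟨C, hC⟩ := h0
  simp only [truncInt, box_eq_Icc] at hC
  set b : (Fin n → ℕ) → Fin n → ℂ := fun p j => ((a j + 1 + p j : ℝ) : ℂ) - lam0 j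
  have hb : ∀ p, IntegrableOn (lapKer (b p) fun r => ∫ s in Icc 0 r, g s) (Ici 0) ∧
      ∫ r in Ici 0, lapKer (b p) (fun r => ∫ s in Icc 0 r, g s) r = 0 := by
    intro p
    have hp : ∀ j, (0 : ℝ) ≤ p j := fun j => Nat.cast_nonneg _
    refine integral_lapKer_integral_Icc_eq_zero hg hC (fun j => ?_) ?_
    · simp only [b, Complex.sub_re, Complex.ofReal_re]
      linarith [ha j, hp j]
    · have hker : lapKer (b p) g = lapKer (fun j => ((a j + 1 + p j : ℝ) : ℂ)) f := by
        rw [hg_def, lapKer_lapKer]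
        congr 1
        funext j
        simp [b]
      have := hzero (fun j => a j + 1 + p j) fun j => by linarith [hp j]
      simp only [LapConvTo, truncInt, hker] at this ⊢
      exact this
  have hae : ∀ᵐ r ∂(volume.restrict (Ici 0)),
      lapKer (b 0) (fun r => ∫ s in Icc 0 r, g s) r = 0 := by
    refine ae_eq_zero_of_moments_eq_zero (hb 0).1 fun p => ?_
    rw [← (hb p).2]
    congr 1
    funext r
    have hbp : b p = (fun j => (p j : ℂ)) + b 0 := by
      funext j
      simp only [b, Pi.add_apply, Pi.zero_apply]
      push_cast
      ring
    rw [hbp, ← lapKer_lapKer, lapKer.eq_1 (fun j => (p j : ℂ)), prod_exp_neg]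
    rw [← Complex.coe_smul]
    congr 1
    push_cast
    refine Finset.prod_congr rfl fun j _ => ?_
    rw [← Complex.exp_nat_mul]
    congr 1
    ring
  have hG : ∀ t, ∫ s in Icc 0 t, g s = 0 := by
    refine integral_Icc_eq_zero_of_ae hg ?_
    filter_upwards [hae] with r hr
    exact (smul_eq_zero.1 hr).resolve_left (Complex.exp_ne_zero _)
  rw [orthant_eq_Ici]
  filter_upwards [ae_eq_zero_of_forall_integral_Icc_eq_zero hg hG] with r hr
  exact (smul_eq_zero.1 hr).resolve_left (Complex.exp_ne_zero _)
end
end
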